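/- For every dimension d ≥ 1 and every μ with 0 < μ < 4d, there exist a finite length L_#(μ) and a finite coupling constant U_#(μ) ≥ 0 such that for every even integer L ≥ L_#(μ) and every U ≥ U_#(μ): if in addition μ is not an eigenvalue of -Δ, then every pair (γ_↑, γ_↓) of one-particle density matrices minimizing the HFz functional satisfies either γ_↑ = 1[-Δ < μ] and γ_↓ = 0, or γ_↑ = 0 and γ_↓ = 1[-Δ < μ], where 1[-Δ < μ] is the spectral projection of -Δ onto the interval (-∞, μ). -/

import Mathlib

open Matrix
open scoped BigOperators Classical ComplexOrder

noncomputable section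

/-- The discrete torus `Λ = (ℤ/Lℤ)^d`. -/
abbrev Lam (d L : ℕ) : Type := Fin d → ZMod L

/-- `x` and `y` are nearest neighbors on the torus (ℓ¹-distance 1). -/
def isNN {d L : ℕ} (x y : Lam d L) : Prop :=
  ∃ ν : Fin d, (x ν = y ν + 1 ∨ x ν + 1 = y ν) ∧ ∀ μ : Fin d, μ ≠ ν → x μ = y μ

/-- The discrete Laplacian `Δ = T - 2d·Id` on the torus. -/
def lap (d L : ℕ) : Matrix (Lam d L) (Lam d L) ℂ :=
  (Matrix.of fun x y => if isNN x y then (1 : ℂ) else 0) - (2 * (d : ℂ)) • 1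

/-- A one-particle density matrix: hermitian with `0 ≤ γ ≤ 1` as quadratic forms. -/
def IsDM {d L : ℕ} [NeZero L] (γ : Matrix (Lam d L) (Lam d L) ℂ) : Prop :=
  γ.PosSemidef ∧ (1 - γ).PosSemidef

/-- `Tr{[X]_-}`: the sum of the negative eigenvalues of a hermitian matrix `X`
(junk value `0` if `X` is not hermitian). -/
def negTrace {n : Type} [Fintype n] [DecidableEq n] (X : Matrix n n ℂ) : ℝ :=
  if hX : X.IsHermitian then ∑ i, min (hX.eigenvalues i) 0 else 0

/-- The HFz energy functional. -/
def hfzE {d L : ℕ} [NeZero L] (μ U : ℝ) (γu γd : Matrix (Lam d L) (Lam d L) ℂ) : ℝ :=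
  (((-(lap d L) - (μ : ℂ) • 1) * (γu + γd)).trace).re
    + U * ∑ x, (γu x x).re * (γd x x).re

/-- The set of HFz energy values over pairs of one-particle density matrices. -/
def hfzEnergies (d L : ℕ) [NeZero L] (μ U : ℝ) : Set ℝ :=
  { E | ∃ γu γd : Matrix (Lam d L) (Lam d L) ℂ, IsDM γu ∧ IsDM γd ∧ hfzE μ U γu γd = E }

/-- The spectral projection `1[X < μ]` of a hermitian matrix `X` onto `(-∞, μ)`
(junk value `0` if `X` is not hermitian). -/
def specProjLt {n : Type} [Fintype n] [DecidableEq n] (X : Matrix n n ℂ) (μ : ℝ) :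
    Matrix n n ℂ :=
  if hX : X.IsHermitian then
    (hX.eigenvectorUnitary : Matrix n n ℂ) *
      Matrix.diagonal (fun i => if hX.eigenvalues i < μ then (1 : ℂ) else 0) *
      (star (hX.eigenvectorUnitary : Matrix n n ℂ))
  else 0

section PosSemidef

theorem norm_sq_apply_le_of_posSemidef {n : Type} {γ : Matrix n n ℂ} (h : γ.PosSemidef) (x y : n) :
    ‖γ x y‖ ^ 2 ≤ (γ x x).re * (γ y y).re := by
  have hdet := (h.submatrix ![x, y]).det_nonneg
  rw [Matrix.det_fin_two] at hdet
  simp only [Matrix.submatrix_apply, Matrix.cons_val_zero, Matrix.cons_val_one] at hdet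
  have hyx : γ y x = star (γ x y) := (h.isHermitian.apply y x).symm
  have hx := (Complex.le_def.1 (h.diag_nonneg (i := x))).2
  have hre := (Complex.le_def.1 hdet).1
  rw [hyx] at hre
  simp only [Complex.zero_re, Complex.sub_re, Complex.mul_re, Complex.zero_im] at hre hx
  rw [← hx] at hre
  rw [Complex.sq_norm, Complex.normSq_apply]
  simp only [RCLike.star_def, Complex.conj_re, Complex.conj_im] at hre
  linarith

theorem re_diag_nonneg_of_posSemidef {n : Type} {γ : Matrix n n ℂ} (h : γ.PosSemidef) (x : n) :
    0 ≤ (γ x x).re :=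
  (Complex.le_def.1 (h.diag_nonneg (i := x))).1

theorem row_eq_zero_of_posSemidef {n : Type} {γ : Matrix n n ℂ} (h : γ.PosSemidef) {x : n}
    (hx : (γ x x).re = 0) (y : n) : γ x y = 0 := by
  have := norm_sq_apply_le_of_posSemidef h x y
  rw [hx, zero_mul] at this
  exact norm_eq_zero.1 (pow_eq_zero_iff two_ne_zero |>.1 (le_antisymm this (sq_nonneg _)))

theorem eq_zero_of_posSemidef_of_diag_eq_zero {n : Type} {γ : Matrix n n ℂ} (h : γ.PosSemidef)
    (hd : ∀ x, (γ x x).re = 0) : γ = 0 := by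
  ext x y
  exact row_eq_zero_of_posSemidef h (hd x) y

variable {n : Type} [Fintype n] [DecidableEq n]

theorem posSemidef_sub_mul_self {γ : Matrix n n ℂ} (h : γ.PosSemidef) (h' : (1 - γ).PosSemidef) :
    (γ - γ * γ).PosSemidef := by
  have e : γ - γ * γ = (1 - γ)ᴴ * γ * (1 - γ) + γᴴ * (1 - γ) * γ := by
    rw [h.isHermitian.eq, h'.isHermitian.eq]
    noncomm_ring
  rw [e]
  exact (h.conjTranspose_mul_mul_same _).add (h'.conjTranspose_mul_mul_same _)

theorem sum_norm_sq_col_le {γ : Matrix n n ℂ} (h : γ.PosSemidef) (h' : (1 - γ).PosSemidef)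
    (k : n) : ∑ j, ‖γ j k‖ ^ 2 ≤ (γ k k).re := by
  have key := re_diag_nonneg_of_posSemidef (posSemidef_sub_mul_self h h') k
  have e : ((γ * γ) k k).re = ∑ j, ‖γ j k‖ ^ 2 := by
    rw [Matrix.mul_apply, Complex.re_sum]
    refine Finset.sum_congr rfl fun j _ => ?_
    rw [← h.isHermitian.apply k j, RCLike.star_def, ← Complex.normSq_eq_conj_mul_self,
      Complex.ofReal_re, Complex.normSq_eq_norm_sq]
  rw [Matrix.sub_apply, Complex.sub_re, e] at key
  linarith

theorem sum_norm_sq_row_le {γ : Matrix n n ℂ} (h : γ.PosSemidef) (h' : (1 - γ).PosSemidef)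
    (k : n) : ∑ j, ‖γ k j‖ ^ 2 ≤ (γ k k).re := by
  refine le_trans (le_of_eq ?_) (sum_norm_sq_col_le h h' k)
  refine Finset.sum_congr rfl fun j _ => ?_
  rw [← h.isHermitian.apply k j, norm_star]

/-- The off-diagonal part of `X` between negative and positive energies is controlled by the
energy excess of a density matrix `G ≤ X`. -/
theorem sum_neg_mul_pos_le_excess {G X : Matrix n n ℂ} (hG : G.PosSemidef)
    (hXG : (X - G).PosSemidef) (hX : (1 - X).PosSemidef) (e : n → ℝ) {K : ℝ}
    (hK : ∀ k, |e k| ≤ K) :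
    ∑ k, ∑ l, max (-e k) 0 * max (e l) 0 * ‖X k l‖ ^ 2 ≤
      2 * K * (∑ k, e k * (G k k).re + ∑ k, max (-e k) 0 * (X k k).re) := by
  have hG1 : (1 - G).PosSemidef := by
    have : 1 - G = (1 - X) + (X - G) := by abel
    rw [this]; exact hX.add hXG
  have hR1 : (1 - (X - G)).PosSemidef := by
    have : 1 - (X - G) = (1 - X) + G := by abel
    rw [this]; exact hX.add hG
  have hp : ∀ k, 0 ≤ max (e k) 0 := fun k => le_max_right _ _
  have hm : ∀ k, 0 ≤ max (-e k) 0 := fun k => le_max_right _ _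
  have hpK : ∀ k, max (e k) 0 ≤ K := fun k =>
    max_le ((le_abs_self _).trans (hK k)) ((abs_nonneg _).trans (hK k))
  have hmK : ∀ k, max (-e k) 0 ≤ K := fun k =>
    max_le ((neg_le_abs _).trans (hK k)) ((abs_nonneg _).trans (hK k))
  have hsplit : ∀ k l, ‖X k l‖ ^ 2 ≤ 2 * ‖G k l‖ ^ 2 + 2 * ‖(X - G) k l‖ ^ 2 := by
    intro k l
    have h1 : ‖X k l‖ ≤ ‖G k l‖ + ‖(X - G) k l‖ := by
      have : X k l = G k l + (X - G) k l := by simp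
      rw [this]; exact norm_add_le _ _
    nlinarith [norm_nonneg (X k l), norm_nonneg (G k l), norm_nonneg ((X - G) k l),
      sq_nonneg (‖G k l‖ - ‖(X - G) k l‖)]
  have hGpart : ∑ k, ∑ l, max (-e k) 0 * max (e l) 0 * ‖G k l‖ ^ 2 ≤
      K * ∑ l, max (e l) 0 * (G l l).re := by
    rw [Finset.sum_comm, Finset.mul_sum]
    refine Finset.sum_le_sum fun l _ => ?_
    calc ∑ k, max (-e k) 0 * max (e l) 0 * ‖G k l‖ ^ 2
        ≤ ∑ k, K * max (e l) 0 * ‖G k l‖ ^ 2 := Finset.sum_le_sum fun k _ => by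
          have := hmK k; have := hp l; gcongr
      _ = K * max (e l) 0 * ∑ k, ‖G k l‖ ^ 2 := by rw [Finset.mul_sum]
      _ ≤ K * max (e l) 0 * (G l l).re :=
          mul_le_mul_of_nonneg_left (sum_norm_sq_col_le hG hG1 l)
            (mul_nonneg ((hp l).trans (hpK l)) (hp l))
      _ = K * (max (e l) 0 * (G l l).re) := by ring
  have hRpart : ∑ k, ∑ l, max (-e k) 0 * max (e l) 0 * ‖(X - G) k l‖ ^ 2 ≤
      K * ∑ k, max (-e k) 0 * ((X - G) k k).re := by
    rw [Finset.mul_sum]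
    refine Finset.sum_le_sum fun k _ => ?_
    calc ∑ l, max (-e k) 0 * max (e l) 0 * ‖(X - G) k l‖ ^ 2
        ≤ ∑ l, max (-e k) 0 * K * ‖(X - G) k l‖ ^ 2 := Finset.sum_le_sum fun l _ => by
          have := hpK l; have := hm k; gcongr
      _ = max (-e k) 0 * K * ∑ l, ‖(X - G) k l‖ ^ 2 := by rw [Finset.mul_sum]
      _ ≤ max (-e k) 0 * K * ((X - G) k k).re :=
          mul_le_mul_of_nonneg_left (sum_norm_sq_row_le hXG hR1 k)
            (mul_nonneg (hm k) ((hm k).trans (hmK k)))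
      _ = K * (max (-e k) 0 * ((X - G) k k).re) := by ring
  have htot : ∑ l, max (e l) 0 * (G l l).re + ∑ k, max (-e k) 0 * ((X - G) k k).re =
      ∑ k, e k * (G k k).re + ∑ k, max (-e k) 0 * (X k k).re := by
    rw [← Finset.sum_add_distrib, ← Finset.sum_add_distrib]
    refine Finset.sum_congr rfl fun k _ => ?_
    have : max (e k) 0 = e k + max (-e k) 0 := by
      rcases le_total (e k) 0 with h | h
      · rw [max_eq_right h, max_eq_left (by linarith)]; ring
      · rw [max_eq_left h, max_eq_right (by linarith)]; ring
    rw [this, Matrix.sub_apply, Complex.sub_re]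
    ring
  calc ∑ k, ∑ l, max (-e k) 0 * max (e l) 0 * ‖X k l‖ ^ 2
      ≤ ∑ k, ∑ l, (2 * (max (-e k) 0 * max (e l) 0 * ‖G k l‖ ^ 2) +
          2 * (max (-e k) 0 * max (e l) 0 * ‖(X - G) k l‖ ^ 2)) := by
        refine Finset.sum_le_sum fun k _ => Finset.sum_le_sum fun l _ => ?_
        have := mul_le_mul_of_nonneg_left (hsplit k l) (mul_nonneg (hm k) (hp l))
        linarith
    _ = 2 * ∑ k, ∑ l, max (-e k) 0 * max (e l) 0 * ‖G k l‖ ^ 2 +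
          2 * ∑ k, ∑ l, max (-e k) 0 * max (e l) 0 * ‖(X - G) k l‖ ^ 2 := by
        simp only [Finset.sum_add_distrib, Finset.mul_sum]
    _ ≤ 2 * K * (∑ l, max (e l) 0 * (G l l).re + ∑ k, max (-e k) 0 * ((X - G) k k).re) := by
        linarith
    _ = _ := by rw [htot]

/-- A density matrix minimizing the one-particle energy of `X - μ` is the spectral projection
onto `(-∞, μ)`, provided `μ` is not an eigenvalue of `X`. -/
theorem eq_specProjLt_of_minimizer {X : Matrix n n ℂ} (hX : X.IsHermitian) (μ : ℝ)
    (hμ : ∀ v : n → ℂ, X.mulVec v = (μ : ℂ) • v → v = 0) {γ : Matrix n n ℂ}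
    (hγ : γ.PosSemidef) (hγ1 : (1 - γ).PosSemidef)
    (hmin : ∀ γ' : Matrix n n ℂ, γ'.PosSemidef → (1 - γ').PosSemidef →
      ((X - (μ : ℂ) • 1) * γ).trace.re ≤ ((X - (μ : ℂ) • 1) * γ').trace.re) :
    γ = specProjLt X μ := by
  set W : Matrix n n ℂ := (hX.eigenvectorUnitary : Matrix n n ℂ) with hW
  have hWW : star W * W = 1 := Unitary.coe_star_mul_self hX.eigenvectorUnitary
  have hWW' : W * star W = 1 := Unitary.coe_mul_star_self hX.eigenvectorUnitary
  set ev := hX.eigenvalues with hev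
  have hspec : X = W * diagonal (fun i => (ev i : ℂ)) * star W := by
    have := hX.spectral_theorem
    rw [Unitary.conjStarAlgAut_apply] at this
    exact this
  have hne : ∀ i, ev i ≠ μ := by
    intro i hi
    have h1 := hX.mulVec_eigenvectorBasis i
    have h2 := hμ (hX.eigenvectorBasis i) (by
      rw [h1, ← hev, hi]; ext j; simp [Pi.smul_apply])
    have h3 := hX.eigenvectorBasis.orthonormal.ne_zero i
    apply h3
    ext j
    exact congrFun h2 j
  have htr : ∀ γ' : Matrix n n ℂ, ((X - (μ : ℂ) • 1) * γ').trace.re =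
      ∑ i, (ev i - μ) * ((star W * γ' * W) i i).re := by
    intro γ'
    have e1 : X - (μ : ℂ) • 1 = W * diagonal (fun i => ((ev i - μ : ℝ) : ℂ)) * star W := by
      have : (diagonal (fun i => ((ev i - μ : ℝ) : ℂ)) : Matrix n n ℂ) =
          diagonal (fun i => (ev i : ℂ)) - (μ : ℂ) • 1 := by
        ext i j
        by_cases hij : i = j
        · subst hij; simp
        · simp [hij]
      rw [this, mul_sub, sub_mul, ← hspec]
      simp [hWW']
    rw [e1, show W * diagonal (fun i => ((ev i - μ : ℝ) : ℂ)) * star W * γ' =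
      W * (diagonal (fun i => ((ev i - μ : ℝ) : ℂ)) * (star W * γ')) by
        simp only [Matrix.mul_assoc], Matrix.trace_mul_comm, Matrix.mul_assoc, Matrix.trace,
      Complex.re_sum]
    refine Finset.sum_congr rfl fun i _ => ?_
    rw [Matrix.diag_apply, Matrix.diagonal_mul, Complex.re_ofReal_mul]
  set f : n → ℂ := fun i => if ev i < μ then (1 : ℂ) else 0 with hf
  have hP : specProjLt X μ = W * diagonal f * star W := by
    rw [specProjLt, dif_pos hX]
  have hstar : star W = Wᴴ := rfl
  have hPpos : (specProjLt X μ).PosSemidef := by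
    rw [hP, hstar]
    apply PosSemidef.mul_mul_conjTranspose_same
    apply PosSemidef.diagonal
    intro i
    simp only [hf, Pi.zero_apply]
    split_ifs <;> simp
  have hP1 : (1 - specProjLt X μ).PosSemidef := by
    have : 1 - specProjLt X μ = W * diagonal (fun i => 1 - f i) * Wᴴ := by
      have e : (diagonal (fun i => 1 - f i) : Matrix n n ℂ) = 1 - diagonal f := by
        rw [← Matrix.diagonal_one, Matrix.diagonal_sub]
      rw [e, mul_sub, sub_mul, hP, mul_one, ← hstar, hWW']
    rw [this]
    apply PosSemidef.mul_mul_conjTranspose_same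
    apply PosSemidef.diagonal
    intro i
    simp only [hf, Pi.zero_apply]
    split_ifs <;> simp
  have hle := hmin _ hPpos hP1
  rw [htr, htr] at hle
  have hPd : star W * specProjLt X μ * W = diagonal f := by
    rw [hP]
    calc star W * (W * diagonal f * star W) * W
        = (star W * W) * diagonal f * (star W * W) := by simp only [Matrix.mul_assoc]
      _ = diagonal f := by rw [hWW]; simp
  rw [hPd] at hle
  set G : Matrix n n ℂ := star W * γ * W with hG
  have hGpos : G.PosSemidef := hγ.conjTranspose_mul_mul_same W
  have hG1 : (1 - G).PosSemidef := by
    have : 1 - G = Wᴴ * (1 - γ) * W := by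
      rw [mul_sub, sub_mul, mul_one, ← hstar, hWW]
    rw [this]; exact hγ1.conjTranspose_mul_mul_same W
  have hterm : ∀ i, 0 ≤ (ev i - μ) * ((G i i).re - (f i).re) := by
    intro i
    have h0 := re_diag_nonneg_of_posSemidef hGpos i
    have h1 := re_diag_nonneg_of_posSemidef hG1 i
    simp only [Matrix.sub_apply, Matrix.one_apply_eq, Complex.sub_re, Complex.one_re] at h1
    by_cases hi : ev i < μ
    · simp only [hf, if_pos hi, Complex.one_re]
      nlinarith
    · simp only [hf, if_neg hi, Complex.zero_re, sub_zero]
      exact mul_nonneg (by linarith) h0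
  have hsum : ∑ i, (ev i - μ) * ((G i i).re - (f i).re) = 0 := by
    apply le_antisymm _ (Finset.sum_nonneg fun i _ => hterm i)
    have e : ∑ i, (ev i - μ) * ((G i i).re - (f i).re) =
        ∑ i, (ev i - μ) * (G i i).re - ∑ i, (ev i - μ) * (f i).re := by
      rw [← Finset.sum_sub_distrib]
      exact Finset.sum_congr rfl fun i _ => mul_sub _ _ _
    rw [e]
    simp only [Matrix.diagonal_apply_eq] at hle
    linarith
  have hdiag : ∀ i, (G i i).re = (f i).re := by
    intro i
    have := (Finset.sum_eq_zero_iff_of_nonneg (fun i _ => hterm i)).1 hsum i (Finset.mem_univ i)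
    rcases mul_eq_zero.1 this with h | h
    · exact absurd (sub_eq_zero.1 h) (hne i)
    · linarith
  have hGf : G = diagonal f := by
    ext i j
    by_cases hi : ev i < μ
    · have h0 : ((1 - G) i i).re = 0 := by
        simp [hdiag i, hf, if_pos hi]
      have h1 := row_eq_zero_of_posSemidef hG1 h0 j
      rw [Matrix.sub_apply, sub_eq_zero] at h1
      rw [← h1]
      by_cases hij : i = j
      · subst hij; simp [hf, hi]
      · simp [hij]
    · have h0 : (G i i).re = 0 := by
        simp [hdiag i, hf, if_neg hi]
      rw [row_eq_zero_of_posSemidef hGpos h0 j]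
      by_cases hij : i = j
      · subst hij; simp [hf, hi]
      · simp [hij]
  rw [hP, ← hGf, hG]
  calc γ = (W * star W) * γ * (W * star W) := by rw [hWW']; simp
    _ = _ := by simp only [Matrix.mul_assoc]

end PosSemidef

section PlaneWaves

variable {d L : ℕ} [NeZero L]

/-- The plane wave with momentum `2πk/L`. -/
def planeWave (k x : Lam d L) : ℂ := ZMod.stdAddChar (k ⬝ᵥ x)

theorem planeWave_add_right (k x y : Lam d L) :
    planeWave k (x + y) = planeWave k x * planeWave k y := by
  simp only [planeWave, dotProduct_add, AddChar.map_add_eq_mul]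

theorem planeWave_comm (k x : Lam d L) : planeWave k x = planeWave x k := by
  simp only [planeWave, dotProduct_comm]

theorem planeWave_add_left (k l x : Lam d L) :
    planeWave (k + l) x = planeWave k x * planeWave l x := by
  simp only [planeWave, add_dotProduct, AddChar.map_add_eq_mul]

theorem norm_stdAddChar (a : ZMod L) : ‖(ZMod.stdAddChar a : ℂ)‖ = 1 :=
  AddChar.norm_apply _ _

theorem conj_planeWave (k x : Lam d L) :
    (starRingEnd ℂ) (planeWave k x) = planeWave (-k) x := by
  rw [planeWave, planeWave, neg_dotProduct, AddChar.map_neg_eq_conj]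

theorem planeWave_single (k : Lam d L) (ν : Fin d) (a : ZMod L) :
    planeWave k (Pi.single ν a) = ZMod.stdAddChar (k ν * a) := by
  simp only [planeWave, dotProduct_single]

theorem sum_planeWave (k : Lam d L) :
    ∑ x, planeWave k x = if k = 0 then (Fintype.card (Lam d L) : ℂ) else 0 := by
  let ψ : AddChar (Lam d L) ℂ :=
    { toFun := planeWave k
      map_zero_eq_one' := by simp [planeWave]
      map_add_eq_mul' := planeWave_add_right k }
  have h := AddChar.sum_eq_ite ψ
  have hψ : ψ = 0 ↔ k = 0 := by
    constructor
    · intro h0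
      ext ν
      have h1 : planeWave k (Pi.single ν 1) = 1 := DFunLike.congr_fun h0 (Pi.single ν 1)
      rw [planeWave_single, mul_one,
        ← (ZMod.stdAddChar (N := L)).map_zero_eq_one] at h1
      exact ZMod.injective_stdAddChar h1
    · intro h0
      ext x
      change planeWave k x = 1
      simp [planeWave, h0]
  simp only [hψ] at h
  exact h

/-- The matrix of normalized plane waves. -/
def fourierMatrix (d L : ℕ) [NeZero L] : Matrix (Lam d L) (Lam d L) ℂ :=
  Matrix.of fun x k => (((√(Fintype.card (Lam d L) : ℝ))⁻¹ : ℝ) : ℂ) * planeWave k x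

theorem card_lam_pos : (0 : ℝ) < Fintype.card (Lam d L) := by
  exact_mod_cast Fintype.card_pos

theorem inv_sqrt_card_mul_self :
    (((√(Fintype.card (Lam d L) : ℝ))⁻¹ : ℝ) : ℂ) * (((√(Fintype.card (Lam d L) : ℝ))⁻¹ : ℝ) : ℂ)
      = (Fintype.card (Lam d L) : ℂ)⁻¹ := by
  rw [← Complex.ofReal_mul, ← mul_inv, Real.mul_self_sqrt card_lam_pos.le]
  push_cast
  rfl

theorem fourierMatrix_conjTranspose_mul_mul_diagonal (f : Lam d L → ℂ) (k l : Lam d L) :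
    ((fourierMatrix d L)ᴴ * diagonal f * fourierMatrix d L) k l =
      (Fintype.card (Lam d L) : ℂ)⁻¹ * ∑ x, f x * planeWave (l - k) x := by
  rw [Matrix.mul_apply, Finset.mul_sum]
  refine Finset.sum_congr rfl fun x _ => ?_
  rw [Matrix.mul_diagonal, Matrix.conjTranspose_apply, ← inv_sqrt_card_mul_self]
  simp only [fourierMatrix, Matrix.of_apply, RCLike.star_def, map_mul, Complex.conj_ofReal,
    conj_planeWave, sub_eq_add_neg l k, planeWave_add_left]
  ring

theorem fourierMatrix_conjTranspose_mul_self :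
    (fourierMatrix d L)ᴴ * fourierMatrix d L = 1 := by
  ext k l
  have h := fourierMatrix_conjTranspose_mul_mul_diagonal (fun _ => 1) k l
  rw [Matrix.diagonal_one, Matrix.mul_one] at h
  simp only [one_mul, sum_planeWave, sub_eq_zero] at h
  rw [h, Matrix.one_apply]
  have hc : (Fintype.card (Lam d L) : ℂ) ≠ 0 := by
    exact_mod_cast (card_lam_pos (d := d) (L := L)).ne'
  by_cases hkl : k = l
  · rw [if_pos hkl.symm, if_pos hkl, inv_mul_cancel₀ hc]
  · rw [if_neg (Ne.symm hkl), if_neg hkl, mul_zero]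

theorem fourierMatrix_mul_conjTranspose_self :
    fourierMatrix d L * (fourierMatrix d L)ᴴ = 1 :=
  mul_eq_one_comm.1 fourierMatrix_conjTranspose_mul_self

/-- Parseval's identity on the torus. -/
theorem sum_norm_sq_sum_planeWave (f : Lam d L → ℂ) :
    ∑ q, ‖∑ x, f x * planeWave q x‖ ^ 2 = Fintype.card (Lam d L) * ∑ x, ‖f x‖ ^ 2 := by
  have hN := card_lam_pos (d := d) (L := L)
  have h1 : ∀ q, (fourierMatrix d L *ᵥ f) q =
      (((√(Fintype.card (Lam d L) : ℝ))⁻¹ : ℝ) : ℂ) * ∑ x, f x * planeWave q x := by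
    intro q
    simp only [Matrix.mulVec, dotProduct, fourierMatrix, Matrix.of_apply, Finset.mul_sum]
    refine Finset.sum_congr rfl fun x _ => ?_
    rw [planeWave_comm]; ring
  have h2 : star (fourierMatrix d L *ᵥ f) ⬝ᵥ (fourierMatrix d L *ᵥ f) = star f ⬝ᵥ f := by
    rw [Matrix.star_mulVec, ← Matrix.dotProduct_mulVec, Matrix.mulVec_mulVec,
      fourierMatrix_conjTranspose_mul_self, Matrix.one_mulVec]
  have h3 : ∀ g : Lam d L → ℂ, star g ⬝ᵥ g = ((∑ x, ‖g x‖ ^ 2 : ℝ) : ℂ) := by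
    intro g
    rw [dotProduct, Complex.ofReal_sum]
    refine Finset.sum_congr rfl fun x _ => ?_
    rw [Pi.star_apply, RCLike.star_def, ← Complex.normSq_eq_conj_mul_self,
      Complex.normSq_eq_norm_sq]
  rw [h3, h3, Complex.ofReal_inj] at h2
  rw [← h2, Finset.mul_sum]
  refine Finset.sum_congr rfl fun q _ => ?_
  rw [h1, norm_mul, mul_pow, Complex.norm_real, norm_inv, Real.norm_eq_abs, inv_pow, sq_abs,
    Real.sq_sqrt hN.le]
  field_simp

/-- `2 - 2 cos` of the angle belonging to `a`. -/
def cosSymbol (a : ZMod L) : ℝ := 2 - 2 * (ZMod.stdAddChar a : ℂ).re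

theorem cosSymbol_intCast (j : ℤ) :
    cosSymbol (j : ZMod L) = 2 - 2 * Real.cos (2 * Real.pi * j / L) := by
  rw [cosSymbol, ZMod.stdAddChar_coe]
  have : (2 * Real.pi * Complex.I * j / L : ℂ) = ((2 * Real.pi * j / L : ℝ) : ℂ) * Complex.I := by
    push_cast; ring
  rw [this, Complex.exp_ofReal_mul_I_re]

theorem cosSymbol_nonneg (a : ZMod L) : 0 ≤ cosSymbol a := by
  have := (Complex.abs_re_le_norm (ZMod.stdAddChar a : ℂ))
  rw [norm_stdAddChar] at this
  have := (abs_le.1 this).2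
  unfold cosSymbol; linarith

theorem cosSymbol_le (a : ZMod L) : cosSymbol a ≤ 4 := by
  have := (Complex.abs_re_le_norm (ZMod.stdAddChar a : ℂ))
  rw [norm_stdAddChar] at this
  have := (abs_le.1 this).1
  unfold cosSymbol; linarith

theorem norm_sq_stdAddChar_neg_sub_one (a : ZMod L) :
    ‖(ZMod.stdAddChar (-a) : ℂ) - 1‖ ^ 2 = cosSymbol a := by
  have h := norm_stdAddChar a
  rw [AddChar.map_neg_eq_conj, cosSymbol]
  have h2 : ‖(ZMod.stdAddChar a : ℂ)‖ ^ 2 = 1 := by rw [h]; norm_num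
  rw [Complex.sq_norm, Complex.normSq_apply] at h2 ⊢
  simp only [Complex.sub_re, Complex.sub_im, Complex.conj_re, Complex.conj_im, Complex.one_re,
    Complex.one_im]
  linarith

theorem sum_sub_shift_mul_planeWave (f : Lam d L → ℂ) (q : Lam d L) (ν : Fin d) :
    ∑ x, (f (x + Pi.single ν 1) - f x) * planeWave q x =
      ((ZMod.stdAddChar (-(q ν)) : ℂ) - 1) * ∑ x, f x * planeWave q x := by
  have h : ∑ x, f (x + Pi.single ν 1) * planeWave q x =
      (ZMod.stdAddChar (-(q ν)) : ℂ) * ∑ x, f x * planeWave q x := by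
    rw [← Equiv.sum_comp (Equiv.addRight (Pi.single ν (1 : ZMod L)))
      (fun x => f x * planeWave q x), Finset.mul_sum]
    refine Finset.sum_congr rfl fun x _ => ?_
    simp only [Equiv.coe_addRight, planeWave_add_right, planeWave_single, mul_one]
    have h1 : (ZMod.stdAddChar (-(q ν)) : ℂ) * ZMod.stdAddChar (q ν) = 1 := by
      rw [← AddChar.map_add_eq_mul, neg_add_cancel, AddChar.map_zero_eq_one]
    linear_combination (-(f (x + Pi.single ν 1) * planeWave q x)) * h1
  simp only [sub_mul, Finset.sum_sub_distrib, h]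
  ring

/-- The dispersion relation of `-Δ`. -/
def dispersion (k : Lam d L) : ℝ := ∑ ν, cosSymbol (k ν)

theorem dispersion_nonneg (k : Lam d L) : 0 ≤ dispersion k :=
  Finset.sum_nonneg fun _ _ => cosSymbol_nonneg _

theorem dispersion_le (k : Lam d L) : dispersion k ≤ 4 * d := by
  refine (Finset.sum_le_sum fun ν _ => cosSymbol_le (k ν)).trans ?_
  simp [mul_comm]

theorem ite_isNN {d L : ℕ} (hL : 3 ≤ L) (x y : Lam d L) :
    (if isNN x y then (1 : ℂ) else 0) =
      ∑ ν, ((if x = y + Pi.single ν 1 then (1 : ℂ) else 0) +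
        if x + Pi.single ν 1 = y then 1 else 0) := by
  have : Fact (1 < L) := ⟨by omega⟩
  have h2 : (2 : ZMod L) ≠ 0 := by
    intro h
    have : ((2 : ℕ) : ZMod L) = 0 := by exact_mod_cast h
    rw [ZMod.natCast_eq_zero_iff] at this
    exact absurd (Nat.le_of_dvd (by norm_num) this) (by omega)
  have key : ∀ ν, (x = y + Pi.single ν 1 ↔ x ν = y ν + 1 ∧ ∀ μ, μ ≠ ν → x μ = y μ) ∧
      (x + Pi.single ν 1 = y ↔ x ν + 1 = y ν ∧ ∀ μ, μ ≠ ν → x μ = y μ) := by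
    intro ν
    refine ⟨⟨fun h => ⟨by simp [h], fun μ hμ => by simp [h, Pi.single_eq_of_ne hμ]⟩, fun h => ?_⟩,
      ⟨fun h => ⟨by simp [← h], fun μ hμ => by simp [← h, Pi.single_eq_of_ne hμ]⟩, fun h => ?_⟩⟩
    · ext μ
      by_cases hμ : μ = ν
      · subst hμ; simp [h.1]
      · simp [Pi.single_eq_of_ne hμ, h.2 μ hμ]
    · ext μ
      by_cases hμ : μ = ν
      · subst hμ; simp [h.1]
      · simp [Pi.single_eq_of_ne hμ, h.2 μ hμ]
  by_cases hxy : isNN x y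
  · rw [if_pos hxy]
    obtain ⟨ν, h1, h3⟩ := hxy
    rw [Finset.sum_eq_single ν]
    · rcases h1 with h1 | h1
      · rw [if_pos ((key ν).1.2 ⟨h1, h3⟩), if_neg, add_zero]
        intro h
        have h4 := ((key ν).2.1 h).1
        rw [h1] at h4
        apply h2
        linear_combination h4
      · rw [if_neg, if_pos ((key ν).2.2 ⟨h1, h3⟩), zero_add]
        intro h
        have h4 := ((key ν).1.1 h).1
        rw [← h1] at h4
        apply h2
        linear_combination -h4
    · intro μ _ hμ
      rw [if_neg, if_neg, add_zero]
      · intro h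
        have h4 := ((key μ).2.1 h).1
        rw [h3 μ hμ] at h4
        exact one_ne_zero (add_eq_left.1 h4)
      · intro h
        have h4 := ((key μ).1.1 h).1
        rw [h3 μ hμ] at h4
        exact one_ne_zero (left_eq_add.1 h4)
    · simp
  · rw [if_neg hxy]
    symm
    apply Finset.sum_eq_zero
    intro ν _
    rw [if_neg, if_neg, add_zero]
    · intro h
      exact hxy ⟨ν, Or.inr ((key ν).2.1 h).1, ((key ν).2.1 h).2⟩
    · intro h
      exact hxy ⟨ν, Or.inl ((key ν).1.1 h).1, ((key ν).1.1 h).2⟩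

theorem neg_lap_mul_fourierMatrix (hL : 3 ≤ L) :
    -(lap d L) * fourierMatrix d L =
      fourierMatrix d L * diagonal (fun k => (dispersion k : ℂ)) := by
  ext x k
  rw [Matrix.mul_diagonal, Matrix.neg_mul, Matrix.neg_apply, lap, Matrix.sub_mul,
    Matrix.sub_apply, Matrix.smul_mul, Matrix.one_mul, Matrix.smul_apply, Matrix.mul_apply]
  have h1 : ∀ y, (Matrix.of (fun x y : Lam d L => if isNN x y then (1 : ℂ) else 0)) x y *
      fourierMatrix d L y k = ∑ ν, ((if y = x - Pi.single ν 1 then fourierMatrix d L y k else 0) +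
        if y = x + Pi.single ν 1 then fourierMatrix d L y k else 0) := by
    intro y
    rw [Matrix.of_apply, ite_isNN hL, Finset.sum_mul]
    refine Finset.sum_congr rfl fun ν _ => ?_
    simp only [add_mul, ite_mul, one_mul, zero_mul, eq_sub_iff_add_eq, @eq_comm _ y (x + _),
      @eq_comm _ x (y + _)]
  simp only [h1]
  rw [Finset.sum_comm]
  simp only [Finset.sum_add_distrib, Finset.sum_ite_eq', Finset.mem_univ, if_true]
  have h2 : ∀ ν, fourierMatrix d L (x - Pi.single ν 1) k + fourierMatrix d L (x + Pi.single ν 1) k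
      = (2 - (cosSymbol (k ν) : ℂ)) * fourierMatrix d L x k := by
    intro ν
    simp only [fourierMatrix, Matrix.of_apply, sub_eq_add_neg, planeWave_add_right,
      ← Pi.single_neg, planeWave_single, mul_one, mul_neg, AddChar.map_neg_eq_conj, cosSymbol]
    have := Complex.add_conj (ZMod.stdAddChar (k ν) : ℂ)
    push_cast at this ⊢
    linear_combination ((((√(Fintype.card (Lam d L) : ℝ)) : ℂ))⁻¹ * planeWave k x) * this
  rw [← Finset.sum_add_distrib, Finset.sum_congr rfl fun ν _ => h2 ν, ← Finset.sum_mul,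
    dispersion]
  simp only [Finset.sum_sub_distrib, Finset.sum_const, Finset.card_univ, Fintype.card_fin,
    nsmul_eq_mul, smul_eq_mul, Complex.ofReal_sum]
  ring

theorem neg_lap_sub_eq (hL : 3 ≤ L) (μ : ℝ) :
    -(lap d L) - (μ : ℂ) • 1 = fourierMatrix d L *
      diagonal (fun k => ((dispersion k - μ : ℝ) : ℂ)) * (fourierMatrix d L)ᴴ := by
  have e : (diagonal (fun k : Lam d L => ((dispersion k - μ : ℝ) : ℂ)) :
      Matrix (Lam d L) (Lam d L) ℂ) =
      diagonal (fun k => (dispersion k : ℂ)) - (μ : ℂ) • 1 := by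
    ext i j
    by_cases hij : i = j
    · subst hij; simp
    · simp [hij]
  rw [e, mul_sub, ← neg_lap_mul_fourierMatrix hL, sub_mul, Matrix.mul_assoc,
    fourierMatrix_mul_conjTranspose_self, mul_one, Matrix.mul_smul, mul_one, Matrix.smul_mul,
    fourierMatrix_mul_conjTranspose_self]

/-- The one-particle energy in momentum space. -/
theorem trace_neg_lap_sub_mul (hL : 3 ≤ L) (μ : ℝ) (γ : Matrix (Lam d L) (Lam d L) ℂ) :
    ((-(lap d L) - (μ : ℂ) • 1) * γ).trace.re = ∑ k, (dispersion k - μ) *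
      (((fourierMatrix d L)ᴴ * γ * fourierMatrix d L) k k).re := by
  rw [neg_lap_sub_eq hL, Matrix.mul_assoc, Matrix.mul_assoc, Matrix.trace_mul_comm,
    Matrix.mul_assoc, Matrix.trace, Complex.re_sum]
  refine Finset.sum_congr rfl fun i _ => ?_
  rw [Matrix.diag_apply, Matrix.diagonal_mul, Complex.re_ofReal_mul]

end PlaneWaves

section Boundary

variable {d L : ℕ} [NeZero L]

/-- Real-valued indicator function of a set of sites. -/
def siteInd (A : Finset (Lam d L)) (x : Lam d L) : ℝ := if x ∈ A then 1 else 0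

theorem siteInd_eq_zero_or_one {d L : ℕ} (A : Finset (Lam d L)) (x : Lam d L) :
    siteInd A x = 0 ∨ siteInd A x = 1 := by
  unfold siteInd; split_ifs <;> simp

theorem sum_siteInd (A : Finset (Lam d L)) : ∑ x, siteInd A x = A.card := by
  simp [siteInd]

/-- Number of nearest-neighbor bonds in direction `ν` that cross the boundary of `A`. -/
def dirBoundary (A : Finset (Lam d L)) (ν : Fin d) : ℝ :=
  ∑ x, (siteInd A (x + Pi.single ν 1) - siteInd A x) ^ 2

/-- Number of nearest-neighbor bonds that cross the boundary of `A`. -/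
def bdryCount (A : Finset (Lam d L)) : ℝ := ∑ ν, dirBoundary A ν

theorem dirBoundary_nonneg (A : Finset (Lam d L)) (ν : Fin d) : 0 ≤ dirBoundary A ν :=
  Finset.sum_nonneg fun _ _ => sq_nonneg _

theorem bdryCount_nonneg (A : Finset (Lam d L)) : 0 ≤ bdryCount A :=
  Finset.sum_nonneg fun _ _ => dirBoundary_nonneg A _

theorem sum_cosSymbol_mul_norm_sq (f : Lam d L → ℝ) (ν : Fin d) :
    ∑ q, cosSymbol (q ν) * ‖∑ x, (f x : ℂ) * planeWave q x‖ ^ 2 =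
      Fintype.card (Lam d L) * ∑ x, (f (x + Pi.single ν 1) - f x) ^ 2 := by
  have h := sum_norm_sq_sum_planeWave (fun x => ((f (x + Pi.single ν 1) : ℂ) - f x))
  simp only [sum_sub_shift_mul_planeWave (fun x => (f x : ℂ)), norm_mul, mul_pow,
    norm_sq_stdAddChar_neg_sub_one] at h
  rw [h]
  simp only [← Complex.ofReal_sub, Complex.norm_real, Real.norm_eq_abs, sq_abs]

theorem sum_cosSymbol_sq_mul_norm_sq (f : Lam d L → ℝ) (ν : Fin d) :
    ∑ q, cosSymbol (q ν) ^ 2 * ‖∑ x, (f x : ℂ) * planeWave q x‖ ^ 2 =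
      Fintype.card (Lam d L) * ∑ x, ((f (x + Pi.single ν 1 + Pi.single ν 1) -
        f (x + Pi.single ν 1)) - (f (x + Pi.single ν 1) - f x)) ^ 2 := by
  have h := sum_cosSymbol_mul_norm_sq (fun x => f (x + Pi.single ν 1) - f x) ν
  beta_reduce at h
  rw [← h]
  refine Finset.sum_congr rfl fun q _ => ?_
  simp only [Complex.ofReal_sub, sum_sub_shift_mul_planeWave (fun x => (f x : ℂ)), norm_mul,
    mul_pow, norm_sq_stdAddChar_neg_sub_one]
  ring

theorem dirBoundary_le_sum_second_difference (A : Finset (Lam d L)) (ν : Fin d) :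
    dirBoundary A ν ≤ ∑ x, ((siteInd A (x + Pi.single ν 1 + Pi.single ν 1) -
      siteInd A (x + Pi.single ν 1)) - (siteInd A (x + Pi.single ν 1) - siteInd A x)) ^ 2 := by
  refine Finset.sum_le_sum fun x _ => ?_
  rcases siteInd_eq_zero_or_one A x with h | h <;>
  rcases siteInd_eq_zero_or_one A (x + Pi.single ν 1) with h' | h' <;>
  rcases siteInd_eq_zero_or_one A (x + Pi.single ν 1 + Pi.single ν 1) with h'' | h'' <;>
  rw [h, h', h''] <;> norm_num

/-- The Fourier transform of an indicator function has a fixed share of its boundary weight at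
high momenta. -/
theorem dirBoundary_le_sum_weight (A : Finset (Lam d L)) (ν : Fin d) {w : Lam d L → ℝ} {c : ℝ}
    (hc : 0 ≤ c) (hw0 : ∀ q, 0 ≤ w q) (hw : ∀ q, 1 / 2 ≤ cosSymbol (q ν) → c ≤ w q) :
    c / 32 * (Fintype.card (Lam d L) * dirBoundary A ν) ≤
      ∑ q, w q * ‖∑ x, (siteInd A x : ℂ) * planeWave q x‖ ^ 2 := by
  have h1 := sum_cosSymbol_mul_norm_sq (siteInd A) ν
  have h2 := sum_cosSymbol_sq_mul_norm_sq (siteInd A) ν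
  have h3 := mul_le_mul_of_nonneg_left (dirBoundary_le_sum_second_difference A ν)
    (card_lam_pos (d := d) (L := L)).le
  rw [← h2] at h3
  have h4 : (Fintype.card (Lam d L) : ℝ) * dirBoundary A ν =
    ∑ q, cosSymbol (q ν) * ‖∑ x, (siteInd A x : ℂ) * planeWave q x‖ ^ 2 := h1.symm
  have h5 : ∑ q, (c / 16) * (cosSymbol (q ν) ^ 2 - cosSymbol (q ν) / 2) *
        ‖∑ x, (siteInd A x : ℂ) * planeWave q x‖ ^ 2 ≤
      ∑ q, w q * ‖∑ x, (siteInd A x : ℂ) * planeWave q x‖ ^ 2 := by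
    refine Finset.sum_le_sum fun q _ => mul_le_mul_of_nonneg_right ?_ (sq_nonneg _)
    have hl0 := cosSymbol_nonneg (q ν)
    have hl4 := cosSymbol_le (q ν)
    by_cases hq : 1 / 2 ≤ cosSymbol (q ν)
    · have := hw q hq
      have : cosSymbol (q ν) ^ 2 - cosSymbol (q ν) / 2 ≤ 16 := by nlinarith
      nlinarith
    · refine le_trans ?_ (hw0 q)
      push Not at hq
      have : cosSymbol (q ν) ^ 2 - cosSymbol (q ν) / 2 ≤ 0 := by nlinarith
      exact mul_nonpos_of_nonneg_of_nonpos (by positivity) this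
  have h6 : ∑ q, (c / 16) * (cosSymbol (q ν) ^ 2 - cosSymbol (q ν) / 2) *
        ‖∑ x, (siteInd A x : ℂ) * planeWave q x‖ ^ 2 =
      (c / 16) * ∑ q, cosSymbol (q ν) ^ 2 * ‖∑ x, (siteInd A x : ℂ) * planeWave q x‖ ^ 2 -
      (c / 32) * ∑ q, cosSymbol (q ν) * ‖∑ x, (siteInd A x : ℂ) * planeWave q x‖ ^ 2 := by
    rw [Finset.mul_sum, Finset.mul_sum, ← Finset.sum_sub_distrib]
    refine Finset.sum_congr rfl fun q _ => ?_
    ring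
  rw [h6, ← h4] at h5
  nlinarith

/-- The absolute value of the ground state energy per site at chemical potential `μ`. -/
def energyDensity (d L : ℕ) [NeZero L] (μ : ℝ) : ℝ :=
  (Fintype.card (Lam d L) : ℝ)⁻¹ * ∑ k : Lam d L, max (-(dispersion k - μ)) 0

/-- Multiplication by the indicator function of `A`. -/
def indMatrix (A : Finset (Lam d L)) : Matrix (Lam d L) (Lam d L) ℂ :=
  diagonal fun x => (siteInd A x : ℂ)

/-- A fermion system confined to `A` has at least the bulk energy plus a boundary energy. -/
theorem boundary_energy (hd : 1 ≤ d) (hL : 3 ≤ L) {μ : ℝ} (hμ0 : 0 < μ) (hμ4 : μ < 4 * d) {c : ℝ}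
    (hc : 0 ≤ c)
    (hw : ∀ (q : Lam d L) (ν : Fin d), 1 / 2 ≤ cosSymbol (q ν) → c * Fintype.card (Lam d L) ≤
      ∑ k : Lam d L, max (-(dispersion k - μ)) 0 * max (dispersion (k + q) - μ) 0)
    (A : Finset (Lam d L)) {γ : Matrix (Lam d L) (Lam d L) ℂ} (hγ : γ.PosSemidef)
    (hγA : (indMatrix A - γ).PosSemidef) :
    c / (256 * d ^ 2) * bdryCount A ≤
      ((-(lap d L) - (μ : ℂ) • 1) * γ).trace.re + energyDensity d L μ * A.card := by
  set F := fourierMatrix d L with hF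
  set N : ℝ := (Fintype.card (Lam d L) : ℝ) with hN
  have hNpos : 0 < N := card_lam_pos
  have hdpos : (0 : ℝ) < d := by exact_mod_cast hd
  set X := Fᴴ * indMatrix A * F with hX
  set G := Fᴴ * γ * F with hG
  have hGpos : G.PosSemidef := hγ.conjTranspose_mul_mul_same F
  have hXG : (X - G).PosSemidef := by
    have : X - G = Fᴴ * (indMatrix A - γ) * F := by rw [mul_sub, sub_mul]
    rw [this]; exact hγA.conjTranspose_mul_mul_same F
  have hX1 : (1 - X).PosSemidef := by
    have h1 : (1 - indMatrix A).PosSemidef := by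
      rw [indMatrix, ← Matrix.diagonal_one, Matrix.diagonal_sub]
      apply PosSemidef.diagonal
      intro x
      rcases siteInd_eq_zero_or_one A x with h | h <;> simp [h]
    have : 1 - X = Fᴴ * (1 - indMatrix A) * F := by
      rw [mul_sub, sub_mul, mul_one, fourierMatrix_conjTranspose_mul_self]
    rw [this]; exact h1.conjTranspose_mul_mul_same F
  have hK : ∀ k : Lam d L, |dispersion k - μ| ≤ 4 * d := by
    intro k
    have h0 := dispersion_nonneg k
    have h4 := dispersion_le k
    rw [abs_le]; constructor <;> linarith
  have key := sum_neg_mul_pos_le_excess hGpos hXG hX1 (fun k => dispersion k - μ) hK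
  have hXkl : ∀ k l, X k l = (N : ℂ)⁻¹ * ∑ x, (siteInd A x : ℂ) * planeWave (l - k) x := by
    intro k l
    rw [hX, indMatrix, fourierMatrix_conjTranspose_mul_mul_diagonal, hN]
    simp
  have hXkk : ∀ k, (X k k).re = N⁻¹ * A.card := by
    intro k
    rw [hXkl, ← Complex.ofReal_inv, Complex.re_ofReal_mul, Complex.re_sum, ← sum_siteInd]
    simp [planeWave]
  have hexc : ∑ k, (dispersion k - μ) * (G k k).re +
      ∑ k, max (-(dispersion k - μ)) 0 * (X k k).re =
      ((-(lap d L) - (μ : ℂ) • 1) * γ).trace.re + energyDensity d L μ * A.card := by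
    rw [trace_neg_lap_sub_mul hL, energyDensity]
    simp only [hXkk, ← Finset.sum_mul]
    ring
  rw [hexc] at key
  have hlhs : ∑ k, ∑ l, max (-(dispersion k - μ)) 0 * max (dispersion l - μ) 0 * ‖X k l‖ ^ 2 =
      N⁻¹ ^ 2 * ∑ q, (∑ k : Lam d L, max (-(dispersion k - μ)) 0 *
        max (dispersion (k + q) - μ) 0) * ‖∑ x, (siteInd A x : ℂ) * planeWave q x‖ ^ 2 := by
    simp only [Finset.sum_mul]
    rw [Finset.sum_comm (γ := Lam d L) (f := fun q k => max (-(dispersion k - μ)) 0 *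
      max (dispersion (k + q) - μ) 0 * ‖∑ x, (siteInd A x : ℂ) * planeWave q x‖ ^ 2),
      Finset.mul_sum]
    refine Finset.sum_congr rfl fun k _ => ?_
    rw [Finset.mul_sum, ← Equiv.sum_comp (Equiv.addLeft k)]
    refine Finset.sum_congr rfl fun q _ => ?_
    rw [hXkl, norm_mul, mul_pow, norm_inv, Complex.norm_real, Real.norm_eq_abs,
      abs_of_pos hNpos]
    simp only [Equiv.coe_addLeft, add_sub_cancel_left]
    ring
  rw [hlhs] at key
  set E := ((-(lap d L) - (μ : ℂ) • 1) * γ).trace.re + energyDensity d L μ * A.card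
  have hdir : ∀ ν : Fin d, c / 32 * dirBoundary A ν ≤ 8 * d * E := by
    intro ν
    have h := dirBoundary_le_sum_weight A ν (mul_nonneg hc hNpos.le)
      (fun q => Finset.sum_nonneg fun k _ => mul_nonneg (le_max_right _ _) (le_max_right _ _))
      (fun q hq => hw q ν hq)
    have h' := mul_le_mul_of_nonneg_left h (sq_nonneg N⁻¹)
    have e : N⁻¹ ^ 2 * (c * N / 32 * (N * dirBoundary A ν)) = c / 32 * dirBoundary A ν := by
      field_simp
    rw [← hN, e] at h'
    linarith
  have hsum : c / 32 * bdryCount A ≤ 8 * d * E * d := by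
    rw [bdryCount, Finset.mul_sum]
    refine (Finset.sum_le_sum fun ν _ => hdir ν).trans ?_
    simp [mul_comm]
  rw [div_mul_eq_mul_div, div_le_iff₀ (by positivity)]
  nlinarith

/-- An entrywise bound on the one-particle hamiltonian. -/
def hopBound (x y : Lam d L) : ℝ :=
  (if x = y then 2 * (d : ℝ) else 0) +
    ∑ ν, ((if x = y + Pi.single ν 1 then (1 : ℝ) else 0) +
      if x + Pi.single ν 1 = y then 1 else 0)

theorem hopBound_nonneg {d L : ℕ} (x y : Lam d L) : 0 ≤ hopBound x y := by
  unfold hopBound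
  refine add_nonneg (by split_ifs <;> positivity) (Finset.sum_nonneg fun ν _ => ?_)
  split_ifs <;> norm_num

theorem norm_neg_lap_sub_le {d L : ℕ} (hL : 3 ≤ L) {μ : ℝ} (hμ0 : 0 < μ) (hμ4 : μ < 4 * d)
    (x y : Lam d L) :
    ‖(-(lap d L) - (μ : ℂ) • 1) x y‖ ≤ hopBound x y := by
  have e : (-(lap d L) - (μ : ℂ) • 1) x y = (if x = y then ((2 * d - μ : ℝ) : ℂ) else 0) -
      (if isNN x y then (1 : ℂ) else 0) := by
    simp only [lap, Matrix.sub_apply, Matrix.neg_apply, Matrix.smul_apply, Matrix.of_apply,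
      Matrix.one_apply, smul_eq_mul]
    split_ifs <;> push_cast <;> ring
  rw [e, ite_isNN hL, hopBound]
  refine (norm_sub_le _ _).trans (add_le_add ?_ ?_)
  · split_ifs
    · rw [Complex.norm_real, Real.norm_eq_abs, abs_le]; constructor <;> linarith
    · simp
  · refine (norm_sum_le _ _).trans (Finset.sum_le_sum fun ν _ => (norm_add_le _ _).trans
      (add_le_add ?_ ?_)) <;> split_ifs <;> simp

theorem sum_sum_hopBound_mul (f : Lam d L → Lam d L → ℝ) :
    ∑ x, ∑ y, hopBound x y * f x y = 2 * d * ∑ x, f x x +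
      ∑ ν, ∑ x, (f (x + Pi.single ν 1) x + f x (x + Pi.single ν 1)) := by
  have h : ∀ x, ∑ y, hopBound x y * f x y = 2 * d * f x x +
      ∑ ν, (f x (x - Pi.single ν 1) + f x (x + Pi.single ν 1)) := by
    intro x
    simp only [hopBound, add_mul, Finset.sum_add_distrib, Finset.sum_mul, ite_mul, zero_mul,
      one_mul, Finset.sum_ite_eq, Finset.mem_univ, if_true]
    congr 1
    congr 1 <;> rw [Finset.sum_comm] <;>
    simp only [← sub_eq_iff_eq_add, Finset.sum_ite_eq, Finset.mem_univ, if_true]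
  simp only [h, Finset.sum_add_distrib, Finset.mul_sum]
  congr 2
  · rw [Finset.sum_comm]
    refine Finset.sum_congr rfl fun ν _ => ?_
    rw [← Equiv.sum_comp (Equiv.addRight (Pi.single ν (1 : ZMod L)))]
    simp
  · rw [Finset.sum_comm]

theorem norm_mul_one_sub_ind_le {γ : Matrix (Lam d L) (Lam d L) ℂ} (hγ : IsDM γ)
    (A : Finset (Lam d L)) {t : ℝ} (ht : 0 < t) (ht1 : t ≤ 1) (x y : Lam d L) :
    ‖γ y x‖ * (1 - siteInd A x * siteInd A y) ≤ (1 / 2) * ((1 - siteInd A x) * (γ x x).re / t +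
      (1 - siteInd A y) * (γ y y).re / t + t * (siteInd A x - siteInd A y) ^ 2) := by
  have h := norm_sq_apply_le_of_posSemidef hγ.1 y x
  have hx0 := re_diag_nonneg_of_posSemidef hγ.1 x
  have hy0 := re_diag_nonneg_of_posSemidef hγ.1 y
  have hx1 := re_diag_nonneg_of_posSemidef hγ.2 x
  have hy1 := re_diag_nonneg_of_posSemidef hγ.2 y
  simp only [Matrix.sub_apply, Matrix.one_apply_eq, Complex.sub_re, Complex.one_re] at hx1 hy1
  have hn := norm_nonneg (γ y x)
  generalize ‖γ y x‖ = g at *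
  generalize (γ x x).re = a at *
  generalize (γ y y).re = b at *
  have amgm : ∀ r : ℝ, 0 ≤ r → g ^ 2 ≤ r → g ≤ 1 / 2 * (r / t + t) := by
    intro r _ hgr
    have : 2 * g * t ≤ g ^ 2 + t ^ 2 := by nlinarith [sq_nonneg (g - t)]
    have e : 1 / 2 * (r / t + t) = (r + t ^ 2) / (2 * t) := by field_simp
    rw [e, le_div_iff₀ (by positivity)]
    linarith
  rcases siteInd_eq_zero_or_one A x with hA | hA <;>
    rcases siteInd_eq_zero_or_one A y with hB | hB <;> rw [hA, hB]
  · have h1 : g ≤ 1 / 2 * (a + b) := by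
      apply le_of_sq_le_sq _ (by positivity)
      nlinarith [sq_nonneg (a - b)]
    have h2 : a ≤ a / t := by rw [le_div_iff₀ ht]; nlinarith
    have h3 : b ≤ b / t := by rw [le_div_iff₀ ht]; nlinarith
    norm_num
    linarith
  · have := amgm a hx0 (by nlinarith)
    norm_num
    linarith
  · have := amgm b hy0 (by nlinarith)
    norm_num
    linarith
  · norm_num

/-- Cutting a density matrix down to `A` costs little energy if the density outside `A` is
small. -/
theorem localization_energy (hL : 3 ≤ L) {μ : ℝ} (hμ0 : 0 < μ) (hμ4 : μ < 4 * d)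
    {γ : Matrix (Lam d L) (Lam d L) ℂ} (hγ : IsDM γ) (A : Finset (Lam d L)) {t : ℝ} (ht : 0 < t)
    (ht1 : t ≤ 1) :
    ((-(lap d L) - (μ : ℂ) • 1) * (indMatrix A * γ * indMatrix A)).trace.re ≤
      ((-(lap d L) - (μ : ℂ) • 1) * γ).trace.re +
        4 * d / t * ∑ x, (1 - siteInd A x) * (γ x x).re + t * bdryCount A := by
  set H := -(lap d L) - (μ : ℂ) • (1 : Matrix (Lam d L) (Lam d L) ℂ) with hH
  have h1 : (H * (indMatrix A * γ * indMatrix A)).trace.re - (H * γ).trace.re =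
      -∑ x, ∑ y, (H x y * γ y x).re * (1 - siteInd A x * siteInd A y) := by
    have tr : ∀ M : Matrix (Lam d L) (Lam d L) ℂ,
        (H * M).trace.re = ∑ x, ∑ y, (H x y * M y x).re := by
      intro M
      simp only [Matrix.trace, Matrix.diag_apply, Matrix.mul_apply, Complex.re_sum]
    rw [tr, tr]
    rw [← Finset.sum_sub_distrib, ← Finset.sum_neg_distrib]
    refine Finset.sum_congr rfl fun x _ => ?_
    rw [← Finset.sum_sub_distrib, ← Finset.sum_neg_distrib]
    refine Finset.sum_congr rfl fun y _ => ?_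
    rw [indMatrix, Matrix.mul_diagonal, Matrix.diagonal_mul,
      show H x y * ((siteInd A y : ℂ) * γ y x * (siteInd A x : ℂ)) =
        ((siteInd A x * siteInd A y : ℝ) : ℂ) * (H x y * γ y x) by push_cast; ring,
      Complex.re_ofReal_mul]
    ring
  have hρ : ∀ x, 0 ≤ (1 - siteInd A x) * (γ x x).re := by
    intro x
    have := re_diag_nonneg_of_posSemidef hγ.1 x
    rcases siteInd_eq_zero_or_one A x with h | h <;> rw [h] <;> simp [this]
  have h2 : ∀ x y, -((H x y * γ y x).re * (1 - siteInd A x * siteInd A y)) ≤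
      hopBound x y * ((1 / 2) * ((1 - siteInd A x) * (γ x x).re / t +
      (1 - siteInd A y) * (γ y y).re / t + t * (siteInd A x - siteInd A y) ^ 2)) := by
    intro x y
    have hi : 0 ≤ 1 - siteInd A x * siteInd A y := by
      rcases siteInd_eq_zero_or_one A x with h | h <;>
        rcases siteInd_eq_zero_or_one A y with h' | h' <;> rw [h, h'] <;> norm_num
    have hr : -(H x y * γ y x).re ≤ hopBound x y * ‖γ y x‖ := by
      refine (neg_le_abs _).trans ((Complex.abs_re_le_norm _).trans ?_)
      rw [norm_mul]
      exact mul_le_mul_of_nonneg_right (norm_neg_lap_sub_le hL hμ0 hμ4 x y) (norm_nonneg _)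
    calc -((H x y * γ y x).re * (1 - siteInd A x * siteInd A y))
        = -(H x y * γ y x).re * (1 - siteInd A x * siteInd A y) := by ring
      _ ≤ hopBound x y * ‖γ y x‖ * (1 - siteInd A x * siteInd A y) :=
          mul_le_mul_of_nonneg_right hr hi
      _ = hopBound x y * (‖γ y x‖ * (1 - siteInd A x * siteInd A y)) := by ring
      _ ≤ _ := mul_le_mul_of_nonneg_left (norm_mul_one_sub_ind_le hγ A ht ht1 x y)
          (hopBound_nonneg x y)
  have h3 : -∑ x, ∑ y, (H x y * γ y x).re * (1 - siteInd A x * siteInd A y) ≤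
      4 * d / t * ∑ x, (1 - siteInd A x) * (γ x x).re + t * bdryCount A := by
    simp only [← Finset.sum_neg_distrib]
    refine (Finset.sum_le_sum fun x _ => Finset.sum_le_sum fun y _ => h2 x y).trans
      (le_of_eq ?_)
    rw [sum_sum_hopBound_mul]
    generalize hr : (fun x => (1 - siteInd A x) * (γ x x).re) = r
    have hr' : ∀ x, (1 - siteInd A x) * (γ x x).re = r x := fun x => congrFun hr x
    have hshift : ∀ ν : Fin d, ∑ x, r (x + Pi.single ν 1) = ∑ x, r x := fun ν => by
      simpa using Equiv.sum_comp (Equiv.addRight (Pi.single ν (1 : ZMod L))) r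
    simp only [hr', sub_self]
    have e1 : ∑ x, (1 / 2 : ℝ) * (r x / t + r x / t + t * 0 ^ 2) = (∑ x, r x) / t := by
      rw [Finset.sum_div]
      refine Finset.sum_congr rfl fun x _ => ?_
      ring
    have e2 : ∀ ν : Fin d, ∑ x, (1 / 2 * (r (x + Pi.single ν 1) / t + r x / t + t *
        (siteInd A (x + Pi.single ν 1) - siteInd A x) ^ 2) + 1 / 2 * (r x / t +
        r (x + Pi.single ν 1) / t + t * (siteInd A x - siteInd A (x + Pi.single ν 1)) ^ 2)) =
        2 * (∑ x, r x) / t + t * dirBoundary A ν := by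
      intro ν
      have : 2 * (∑ x, r x) / t + t * dirBoundary A ν =
          ∑ x, (r (x + Pi.single ν 1) / t + r x / t +
            t * (siteInd A (x + Pi.single ν 1) - siteInd A x) ^ 2) := by
        rw [Finset.sum_add_distrib, Finset.sum_add_distrib, ← Finset.sum_div, ← Finset.sum_div,
          hshift, dirBoundary, ← Finset.mul_sum]
        ring
      rw [this]
      refine Finset.sum_congr rfl fun x _ => ?_
      ring
    simp only [e1, e2, Finset.sum_add_distrib, bdryCount, Finset.mul_sum]
    simp only [Finset.sum_const, Finset.card_univ, Fintype.card_fin, nsmul_eq_mul,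
      ← Finset.mul_sum]
    ring
  linarith

end Boundary

section Counting

/-- Every shift of momentum that is not too small connects some point well below the Fermi
surface with a point well above it. -/
theorem exists_momentum_across_level {d : ℕ} {μ η : ℝ} (hη : η ≤ 1 / 4) (hημ : η ≤ μ)
    (hη4 : η ≤ 4 * d - μ) (q : Fin d → ℝ) (hq0 : ∀ ν, 0 ≤ q ν) (hq2 : ∀ ν, q ν ≤ 2 * Real.pi)
    (ν₀ : Fin d) (hν₀ : 1 / 2 ≤ 2 - 2 * Real.cos (q ν₀)) :
    ∃ θ : Fin d → ℝ, ∑ ν, (2 - 2 * Real.cos (θ ν)) ≤ μ - η ∧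
      μ + η ≤ ∑ ν, (2 - 2 * Real.cos (θ ν + q ν)) := by
  set k : ℝ → Fin d → ℝ := fun t ν => t * (Real.pi - q ν) with hk
  have hf0 : ∀ x : ℝ, 0 ≤ 2 - 2 * Real.cos x := fun x => by linarith [Real.cos_le_one x]
  have hdiff : ∀ t ∈ Set.Icc (0 : ℝ) 1, 1 / 2 ≤
      ∑ ν, (2 - 2 * Real.cos (k t ν + q ν)) - ∑ ν, (2 - 2 * Real.cos (k t ν)) := by
    intro t ht
    rw [← Finset.sum_sub_distrib]
    have h : ∀ ν, 2 - 2 * Real.cos (q ν) ≤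
        2 - 2 * Real.cos (k t ν + q ν) - (2 - 2 * Real.cos (k t ν)) := by
      intro ν
      have hs0 : 0 ≤ Real.sin (q ν / 2) :=
        Real.sin_nonneg_of_nonneg_of_le_pi (by linarith [hq0 ν]) (by linarith [hq2 ν])
      have hx : q ν / 2 ∈ Set.Icc 0 Real.pi := ⟨by linarith [hq0 ν], by linarith [hq2 ν]⟩
      have hy : Real.pi - q ν / 2 ∈ Set.Icc 0 Real.pi :=
        ⟨by linarith [hq2 ν], by linarith [hq0 ν]⟩
      have hconc := strictConcaveOn_sin_Icc.concaveOn.2 hx hy (sub_nonneg.2 ht.2) ht.1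
        (sub_add_cancel 1 t)
      simp only [smul_eq_mul, Real.sin_pi_sub] at hconc
      have e1 : k t ν + q ν = ((1 - t) * (q ν / 2) + t * (Real.pi - q ν / 2)) + q ν / 2 := by
        simp only [hk]; ring
      have e2 : k t ν = ((1 - t) * (q ν / 2) + t * (Real.pi - q ν / 2)) - q ν / 2 := by
        simp only [hk]; ring
      have e3 : Real.cos (q ν) = 1 - 2 * Real.sin (q ν / 2) ^ 2 := by
        have := Real.cos_two_mul (q ν / 2)
        rw [mul_div_cancel₀ _ two_ne_zero] at this
        have h2 := Real.sin_sq_add_cos_sq (q ν / 2)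
        linarith
      rw [e1, e2, e3, Real.cos_add, Real.cos_sub]
      nlinarith
    exact hν₀.trans ((Finset.single_le_sum (f := fun ν => 2 - 2 * Real.cos (q ν))
      (fun ν _ => hf0 _) (Finset.mem_univ ν₀)).trans (Finset.sum_le_sum fun ν _ => h ν))
  set M : ℝ → ℝ := fun t =>
    (∑ ν, (2 - 2 * Real.cos (k t ν)) + ∑ ν, (2 - 2 * Real.cos (k t ν + q ν))) / 2 with hM
  by_cases h0 : μ ≤ M 0
  · refine ⟨k 0, ?_, ?_⟩
    · simp [hk]; linarith
    · simp only [hM, hk, zero_mul, Real.cos_zero, mul_one, sub_self, Finset.sum_const_zero] at h0 ⊢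
      linarith
  by_cases h1 : M 1 ≤ μ
  · have e : ∑ ν : Fin d, (2 - 2 * Real.cos (k 1 ν + q ν)) = 4 * d := by
      simp only [hk, one_mul, sub_add_cancel, Real.cos_pi, Finset.sum_const, Finset.card_univ,
        Fintype.card_fin, nsmul_eq_mul]
      ring
    refine ⟨k 1, ?_, ?_⟩
    · simp only [hM, e] at h1
      linarith
    · linarith
  push Not at h0 h1
  have hcont : Continuous M := by
    simp only [hM, hk]
    fun_prop
  obtain ⟨t, ht, htM⟩ := intermediate_value_Icc zero_le_one hcont.continuousOn
    (show μ ∈ Set.Icc (M 0) (M 1) from ⟨h0.le, h1.le⟩)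
  have := hdiff t ht
  simp only [hM] at htM
  exact ⟨k t, by linarith, by linarith⟩

theorem abs_sum_cos_sub_le {d : ℕ} (θ θ' : Fin d → ℝ) {r : ℝ} (h : ∀ ν, |θ ν - θ' ν| ≤ r) :
    |∑ ν, (2 - 2 * Real.cos (θ ν)) - ∑ ν, (2 - 2 * Real.cos (θ' ν))| ≤ 2 * d * r := by
  rw [← Finset.sum_sub_distrib]
  refine (Finset.abs_sum_le_sum_abs _ _).trans ?_
  have : ∀ ν ∈ Finset.univ, |2 - 2 * Real.cos (θ ν) - (2 - 2 * Real.cos (θ' ν))| ≤ 2 * r := by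
    intro ν _
    have e : 2 - 2 * Real.cos (θ ν) - (2 - 2 * Real.cos (θ' ν)) =
      -2 * (Real.cos (θ ν) - Real.cos (θ' ν)) := by ring
    rw [e, abs_mul, abs_neg, abs_two]
    have := Real.abs_cos_sub_cos_le (θ ν) (θ' ν)
    linarith [h ν]
  refine (Finset.sum_le_sum this).trans (le_of_eq ?_)
  simp only [Finset.sum_const, Finset.card_univ, Fintype.card_fin, nsmul_eq_mul]
  ring

theorem exists_overlap_bound {d : ℕ} (hd : 1 ≤ d) {μ : ℝ} (hμ0 : 0 < μ) (hμ4 : μ < 4 * d) :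
    ∃ c : ℝ, 0 < c ∧ ∃ L₀ : ℕ, ∀ (L : ℕ) [NeZero L], L₀ ≤ L → ∀ (q : Lam d L) (ν : Fin d),
      1 / 2 ≤ cosSymbol (q ν) → c * Fintype.card (Lam d L) ≤
        ∑ k : Lam d L, max (-(dispersion k - μ)) 0 * max (dispersion (k + q) - μ) 0 := by
  have hdpos : (0 : ℝ) < d := by exact_mod_cast hd
  have hd1 : (1 : ℝ) ≤ d := by exact_mod_cast hd
  obtain ⟨η, hηpos, hη, hημ, hη4⟩ : ∃ η : ℝ, 0 < η ∧ η ≤ 1 / 4 ∧ η ≤ μ ∧ η ≤ 4 * d - μ :=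
    ⟨min (1 / 4) (min μ (4 * d - μ)), lt_min (by norm_num) (lt_min hμ0 (by linarith)),
      min_le_left _ _, (min_le_right _ _).trans (min_le_left _ _),
      (min_le_right _ _).trans (min_le_right _ _)⟩
  have hπ := Real.pi_pos
  have hπ3 := Real.pi_gt_three
  refine ⟨(η / (16 * Real.pi * d)) ^ d * (η / 2) ^ 2, by positivity,
    ⌈16 * Real.pi * d / η⌉₊, ?_⟩
  intro L _ hL q ν₀ hν₀
  have hLpos : (0 : ℝ) < L := by exact_mod_cast Nat.pos_of_ne_zero (NeZero.ne L)
  have hL' : 16 * Real.pi * d ≤ L * η := by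
    have := Nat.ceil_le.1 hL
    rwa [div_le_iff₀ hηpos] at this
  set y : ℝ := η * L / (8 * Real.pi * d) with hy
  set m : ℕ := ⌊y⌋₊ with hm
  have hy2 : 2 ≤ y := by rw [hy, le_div_iff₀ (by positivity)]; linarith
  have hmy : (m : ℝ) ≤ y := Nat.floor_le (by linarith)
  have hym : y / 2 ≤ m := by
    have := Nat.lt_floor_add_one y
    rw [← hm] at this
    linarith
  have hm1 : (1 : ℝ) ≤ m := by linarith
  have hmL : m ≤ L := by
    have : y ≤ L := by
      rw [hy, div_le_iff₀ (by positivity)]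
      have : η ≤ 8 * Real.pi * d := by nlinarith
      nlinarith
    exact_mod_cast hmy.trans this
  have hqint : ∀ ν, ((((q ν).val : ℤ)) : ZMod L) = q ν := fun ν => by simp
  set Q : Fin d → ℝ := fun ν => 2 * Real.pi * ((q ν).val : ℤ) / L with hQ
  have hcos : ∀ ν, cosSymbol (q ν) = 2 - 2 * Real.cos (Q ν) := fun ν => by
    rw [← hqint ν, cosSymbol_intCast]
  have hQ0 : ∀ ν, 0 ≤ Q ν := fun ν => by simp only [hQ]; push_cast; positivity
  have hQ2 : ∀ ν, Q ν ≤ 2 * Real.pi := by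
    intro ν
    simp only [hQ]
    rw [div_le_iff₀ hLpos]
    have : (((q ν).val : ℤ) : ℝ) ≤ L := by exact_mod_cast (ZMod.val_lt (q ν)).le
    nlinarith
  rw [hcos] at hν₀
  obtain ⟨θ, hθ, hθq⟩ := exists_momentum_across_level hη hημ hη4 Q hQ0 hQ2 ν₀ hν₀
  set a : Fin d → ℤ := fun ν => ⌊L * θ ν / (2 * Real.pi)⌋ with ha
  let Φ : (Fin d → Fin m) → Lam d L := fun j ν => ((a ν + (j ν : ℕ) : ℤ) : ZMod L)
  have hΦ : Function.Injective Φ := by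
    intro j j' hjj
    funext ν
    have h := congrFun hjj ν
    simp only [Φ, Int.cast_add, Int.cast_natCast, add_right_inj] at h
    rw [ZMod.natCast_eq_natCast_iff', Nat.mod_eq_of_lt ((j ν).2.trans_le hmL),
      Nat.mod_eq_of_lt ((j' ν).2.trans_le hmL)] at h
    exact Fin.ext h
  have hclose : ∀ (j : Fin d → Fin m) ν,
      |2 * Real.pi * ((a ν + (j ν : ℕ) : ℤ) : ℝ) / L - θ ν| ≤ 2 * Real.pi * m / L := by
    intro j ν
    have h1 := Int.floor_le (L * θ ν / (2 * Real.pi))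
    have h2 := Int.lt_floor_add_one (L * θ ν / (2 * Real.pi))
    have hj0 : (0 : ℝ) ≤ ((j ν : ℕ) : ℝ) := by positivity
    have hj1 : ((j ν : ℕ) : ℝ) + 1 ≤ m := by exact_mod_cast (j ν).2
    have e : 2 * Real.pi * ((a ν + (j ν : ℕ) : ℤ) : ℝ) / L - θ ν =
        2 * Real.pi / L * ((a ν : ℝ) + ((j ν : ℕ) : ℝ) - L * θ ν / (2 * Real.pi)) := by
      push_cast
      field_simp
    rw [e, abs_mul, abs_of_pos (show 0 < 2 * Real.pi / (L : ℝ) by positivity),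
      mul_div_right_comm (2 * Real.pi) (m : ℝ)]
    refine mul_le_mul_of_nonneg_left ?_ (by positivity)
    rw [abs_le]
    constructor <;> simp only [ha] <;> linarith
  have hr : 2 * d * (2 * Real.pi * m / L) ≤ η / 2 := by
    have : 2 * d * (2 * Real.pi * y / L) = η / 2 := by
      rw [hy]; field_simp; norm_num
    rw [← this]
    gcongr
  have hlow : ∀ j, dispersion (Φ j) ≤ μ - η / 2 := by
    intro j
    have h := abs_sum_cos_sub_le (fun ν => 2 * Real.pi * ((a ν + (j ν : ℕ) : ℤ) : ℝ) / L) θ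
      (hclose j)
    simp only [dispersion, Φ, cosSymbol_intCast]
    linarith [(abs_le.1 h).2]
  have hhigh : ∀ j, μ + η / 2 ≤ dispersion (Φ j + q) := by
    intro j
    have h := abs_sum_cos_sub_le
      (fun ν => 2 * Real.pi * ((a ν + (j ν : ℕ) + (q ν).val : ℤ) : ℝ) / L) (fun ν => θ ν + Q ν)
      (r := 2 * Real.pi * m / L) (fun ν => by
        refine le_trans (le_of_eq ?_) (hclose j ν)
        congr 1
        simp only [hQ]
        push_cast
        ring)
    have e : dispersion (Φ j + q) = ∑ ν, (2 - 2 * Real.cos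
        (2 * Real.pi * ((a ν + (j ν : ℕ) + (q ν).val : ℤ) : ℝ) / L)) := by
      refine Finset.sum_congr rfl fun ν _ => ?_
      rw [← cosSymbol_intCast, Int.cast_add, hqint]
      rfl
    rw [e]
    linarith [(abs_le.1 h).1]
  set g : Lam d L → ℝ := fun k =>
    max (-(dispersion k - μ)) 0 * max (dispersion (k + q) - μ) 0 with hg
  have hg0 : ∀ k, 0 ≤ g k := fun k => mul_nonneg (le_max_right _ _) (le_max_right _ _)
  have hgΦ : ∀ j, (η / 2) ^ 2 ≤ g (Φ j) := by
    intro j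
    have h1 : η / 2 ≤ max (-(dispersion (Φ j) - μ)) 0 :=
      le_trans (by linarith [hlow j]) (le_max_left _ _)
    have h2 : η / 2 ≤ max (dispersion (Φ j + q) - μ) 0 :=
      le_trans (by linarith [hhigh j]) (le_max_left _ _)
    rw [sq]
    exact mul_le_mul h1 h2 (by positivity) (le_max_right _ _)
  have hcard : (Fintype.card (Lam d L) : ℝ) = (L : ℝ) ^ d := by
    simp [ZMod.card]
  calc (η / (16 * Real.pi * d)) ^ d * (η / 2) ^ 2 * Fintype.card (Lam d L)
      = (y / 2) ^ d * (η / 2) ^ 2 := by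
        rw [hcard, mul_right_comm, ← mul_pow]
        congr 2
        rw [hy]; field_simp; norm_num
    _ ≤ (m : ℝ) ^ d * (η / 2) ^ 2 := by
        have : 0 ≤ y / 2 := by linarith
        gcongr
    _ = ∑ _j : Fin d → Fin m, (η / 2) ^ 2 := by simp
    _ ≤ ∑ j, g (Φ j) := Finset.sum_le_sum fun j _ => hgΦ j
    _ = ∑ k ∈ Finset.univ.image Φ, g k := (Finset.sum_image fun _ _ _ _ h => hΦ h).symm
    _ ≤ ∑ k, g k := Finset.sum_le_univ_sum_of_nonneg hg0

variable {d L : ℕ} [NeZero L]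

theorem le_energyDensity (hd : 1 ≤ d) (hL : Even L) {μ : ℝ} (hμ0 : 0 < μ)
    {c : ℝ} (hw : ∀ (q : Lam d L) (ν : Fin d), 1 / 2 ≤ cosSymbol (q ν) →
      c * Fintype.card (Lam d L) ≤
        ∑ k : Lam d L, max (-(dispersion k - μ)) 0 * max (dispersion (k + q) - μ) 0) :
    c / (4 * d) ≤ energyDensity d L μ := by
  have hdpos : (0 : ℝ) < d := by exact_mod_cast hd
  have hLpos : (0 : ℝ) < L := by exact_mod_cast Nat.pos_of_ne_zero (NeZero.ne L)
  have hN := card_lam_pos (d := d) (L := L)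
  obtain ⟨r, hr⟩ := hL
  have hcos : cosSymbol ((r : ℤ) : ZMod L) = 4 := by
    have e : 2 * Real.pi * (r : ℤ) / L = Real.pi := by
      have : (L : ℝ) = r + r := by exact_mod_cast hr
      rw [div_eq_iff hLpos.ne', this]
      push_cast
      ring
    rw [cosSymbol_intCast, e, Real.cos_pi]
    norm_num
  have h := hw (fun _ => ((r : ℤ) : ZMod L)) ⟨0, hd⟩ (by rw [hcos]; norm_num)
  have h2 : ∑ k : Lam d L, max (-(dispersion k - μ)) 0 *
      max (dispersion (k + fun _ => ((r : ℤ) : ZMod L)) - μ) 0 ≤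
      (∑ k : Lam d L, max (-(dispersion k - μ)) 0) * (4 * d) := by
    rw [Finset.sum_mul]
    refine Finset.sum_le_sum fun k _ => mul_le_mul_of_nonneg_left ?_ (le_max_right _ _)
    exact max_le (by linarith [dispersion_le (k + fun _ => ((r : ℤ) : ZMod L))]) (by positivity)
  rw [energyDensity, div_le_iff₀ (by positivity), mul_assoc, inv_mul_eq_div, le_div_iff₀ hN]
  exact h.trans h2

end Counting

section Minimizers

variable {d L : ℕ} [NeZero L]

theorem eq_empty_or_eq_univ_of_bdryCount_eq_zero {A : Finset (Lam d L)} (h : bdryCount A = 0) :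
    A = ∅ ∨ A = Finset.univ := by
  have h1 : ∀ ν x, siteInd A (x + Pi.single ν 1) = siteInd A x := by
    intro ν x
    have h2 := (Finset.sum_eq_zero_iff_of_nonneg fun ν _ => dirBoundary_nonneg A ν).1 h ν
      (Finset.mem_univ ν)
    have h3 := (Finset.sum_eq_zero_iff_of_nonneg fun _ _ => sq_nonneg _).1 h2 x
      (Finset.mem_univ x)
    exact sub_eq_zero.1 (pow_eq_zero_iff two_ne_zero |>.1 h3)
  have h2 : ∀ (n : ℕ) ν x, siteInd A (x + Pi.single ν (n : ZMod L)) = siteInd A x := by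
    intro n ν
    induction n with
    | zero => simp
    | succ n ih =>
      intro x
      rw [Nat.cast_succ, Pi.single_add, ← add_assoc, h1, ih]
  have h3 : ∀ (s : Finset (Fin d)) (y x : Lam d L),
      siteInd A (x + ∑ ν ∈ s, Pi.single ν (y ν)) = siteInd A x := by
    intro s y
    induction s using Finset.induction_on with
    | empty => simp
    | insert ν s hν ih =>
      intro x
      rw [Finset.sum_insert hν, ← add_assoc, ih, ← ZMod.natCast_zmod_val (y ν), h2]
  have h4 : ∀ x y, siteInd A y = siteInd A x := by
    intro x y
    rw [← h3 Finset.univ (y - x) x, Finset.univ_sum_single, add_sub_cancel]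
  rcases A.eq_empty_or_nonempty with hA | ⟨x, hx⟩
  · exact Or.inl hA
  · refine Or.inr (Finset.eq_univ_iff_forall.2 fun y => ?_)
    have := h4 x y
    simp only [siteInd, hx, if_true] at this
    by_contra hy
    simp [hy] at this

theorem isDM_zero : IsDM (0 : Matrix (Lam d L) (Lam d L) ℂ) :=
  ⟨PosSemidef.zero, by rw [sub_zero]; exact PosSemidef.one⟩

/-- The ground state of free fermions at chemical potential `μ`. -/
theorem exists_isDM_trace_eq (hL : 3 ≤ L) (μ : ℝ) :
    ∃ γ : Matrix (Lam d L) (Lam d L) ℂ, IsDM γ ∧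
      ((-(lap d L) - (μ : ℂ) • 1) * γ).trace.re =
        -(energyDensity d L μ * Fintype.card (Lam d L)) := by
  set F := fourierMatrix d L with hF
  set p : Lam d L → ℂ := fun k => if dispersion k < μ then 1 else 0 with hp
  have hp0 : ∀ k, 0 ≤ p k := fun k => by simp only [hp]; split_ifs <;> simp
  have hp1 : ∀ k, 0 ≤ 1 - p k := fun k => by simp only [hp]; split_ifs <;> simp
  refine ⟨F * diagonal p * Fᴴ, ⟨(PosSemidef.diagonal hp0).mul_mul_conjTranspose_same F, ?_⟩, ?_⟩
  · have e : 1 - F * diagonal p * Fᴴ = F * diagonal (fun k => 1 - p k) * Fᴴ := by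
      rw [← Matrix.diagonal_sub, Matrix.diagonal_one, mul_sub, sub_mul, mul_one,
        fourierMatrix_mul_conjTranspose_self]
    rw [e]
    exact (PosSemidef.diagonal hp1).mul_mul_conjTranspose_same F
  · have e : Fᴴ * (F * diagonal p * Fᴴ) * F = diagonal p := by
      simp only [← Matrix.mul_assoc, hF, fourierMatrix_conjTranspose_mul_self, Matrix.one_mul]
      rw [Matrix.mul_assoc, fourierMatrix_conjTranspose_mul_self, Matrix.mul_one]
    rw [trace_neg_lap_sub_mul hL, e, energyDensity, mul_comm,
      mul_inv_cancel_left₀ card_lam_pos.ne', ← Finset.sum_neg_distrib]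
    refine Finset.sum_congr rfl fun k _ => ?_
    rw [Matrix.diagonal_apply_eq]
    by_cases hk : dispersion k < μ
    · rw [max_eq_left (by linarith)]
      simp [hp, hk]
    · rw [max_eq_right (by linarith)]
      simp [hp, hk]

theorem isHermitian_neg_lap (hL : 3 ≤ L) : (-(lap d L)).IsHermitian := by
  have h := neg_lap_sub_eq (d := d) hL 0
  rw [Complex.ofReal_zero, zero_smul, sub_zero] at h
  rw [h]
  refine isHermitian_mul_mul_conjTranspose _ (Matrix.isHermitian_diagonal_of_self_adjoint _ ?_)
  ext k
  simp

/-- A lower bound for the energy of one spin component: away from `A`, density costs at most a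
fixed amount of energy, and the boundary of `A` costs a positive amount. -/
theorem le_trace_of_boundary (hd : 1 ≤ d) (hL : 3 ≤ L) {μ : ℝ} (hμ0 : 0 < μ) (hμ4 : μ < 4 * d)
    {c : ℝ} (hc : 0 ≤ c)
    (hw : ∀ (q : Lam d L) (ν : Fin d), 1 / 2 ≤ cosSymbol (q ν) → c * Fintype.card (Lam d L) ≤
      ∑ k : Lam d L, max (-(dispersion k - μ)) 0 * max (dispersion (k + q) - μ) 0)
    {t : ℝ} (ht : 0 < t) (ht1 : t ≤ 1) (A : Finset (Lam d L))
    {γ : Matrix (Lam d L) (Lam d L) ℂ} (hγ : IsDM γ) :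
    (c / (256 * d ^ 2) - t) * bdryCount A - 4 * d / t * ∑ x, (1 - siteInd A x) * (γ x x).re -
      energyDensity d L μ * A.card ≤ ((-(lap d L) - (μ : ℂ) • 1) * γ).trace.re := by
  have hstar : (indMatrix A)ᴴ = indMatrix A := by
    rw [indMatrix, Matrix.diagonal_conjTranspose]
    congr 1
    ext x
    simp
  have hsq : indMatrix A * indMatrix A = indMatrix A := by
    rw [indMatrix, Matrix.diagonal_mul_diagonal]
    congr 1
    ext x
    rcases siteInd_eq_zero_or_one A x with h | h <;> simp [h]
  have h1 : (indMatrix A * γ * indMatrix A).PosSemidef := by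
    simpa only [hstar] using hγ.1.conjTranspose_mul_mul_same (indMatrix A)
  have h2 : (indMatrix A - indMatrix A * γ * indMatrix A).PosSemidef := by
    have := hγ.2.conjTranspose_mul_mul_same (indMatrix A)
    rwa [hstar, mul_sub, sub_mul, mul_one, hsq] at this
  have h3 := boundary_energy hd hL hμ0 hμ4 hc hw A h1 h2
  have h4 := localization_energy hL hμ0 hμ4 hγ A ht ht1
  linarith

theorem hfzE_zero_right (μ U : ℝ) (γ : Matrix (Lam d L) (Lam d L) ℂ) :
    hfzE μ U γ 0 = ((-(lap d L) - (μ : ℂ) • 1) * γ).trace.re := by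
  simp [hfzE]

theorem hfzE_zero_left (μ U : ℝ) (γ : Matrix (Lam d L) (Lam d L) ℂ) :
    hfzE μ U 0 γ = ((-(lap d L) - (μ : ℂ) • 1) * γ).trace.re := by
  simp [hfzE]

/-- At strong coupling, a state with at most the energy of the saturated state is fully
polarized. -/
theorem eq_zero_or_eq_zero_of_hfzE_le (hd : 1 ≤ d) (hL : 3 ≤ L) {μ : ℝ} (hμ0 : 0 < μ)
    (hμ4 : μ < 4 * d) {c : ℝ} (hc : 0 ≤ c)
    (hw : ∀ (q : Lam d L) (ν : Fin d), 1 / 2 ≤ cosSymbol (q ν) → c * Fintype.card (Lam d L) ≤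
      ∑ k : Lam d L, max (-(dispersion k - μ)) 0 * max (dispersion (k + q) - μ) 0)
    {t δ U : ℝ} (ht : 0 < t) (ht1 : t ≤ 1) (htc : t < c / (256 * d ^ 2)) (hδ : 0 < δ)
    (hδh : 4 * d / t * (2 * δ) < energyDensity d L μ) (hU : 4 * d / t / δ < U)
    {γu γd : Matrix (Lam d L) (Lam d L) ℂ} (hu : IsDM γu) (hdn : IsDM γd)
    (hE : hfzE μ U γu γd ≤ -(energyDensity d L μ * Fintype.card (Lam d L))) :
    γu = 0 ∨ γd = 0 := by
  set ρ : Lam d L → ℝ := fun x => (γu x x).re with hρ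
  set ρ' : Lam d L → ℝ := fun x => (γd x x).re with hρ'
  have hρ0 : ∀ x, 0 ≤ ρ x := re_diag_nonneg_of_posSemidef hu.1
  have hρ0' : ∀ x, 0 ≤ ρ' x := re_diag_nonneg_of_posSemidef hdn.1
  set A : Finset (Lam d L) := Finset.univ.filter fun x => δ ≤ ρ x with hA
  set B : Finset (Lam d L) := Finset.univ.filter fun x => ρ x < δ ∧ δ ≤ ρ' x with hB
  set h := energyDensity d L μ with hh
  set N : ℝ := (Fintype.card (Lam d L) : ℝ) with hN
  set K : ℝ := 4 * d / t with hK
  have hKpos : 0 ≤ K := by positivity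
  have hpt : ∀ x, 0 ≤ 1 - siteInd A x - siteInd B x ∧
      (1 - siteInd A x) * ρ x + (1 - siteInd B x) * ρ' x ≤
        ρ x * ρ' x / δ + 2 * δ * (1 - siteInd A x - siteInd B x) := by
    intro x
    have hdiv : ∀ r s : ℝ, 0 ≤ s → δ ≤ r → s ≤ r * s / δ := by
      intro r s hs hr
      rw [le_div_iff₀ hδ]
      nlinarith
    have hP : 0 ≤ ρ x * ρ' x / δ := div_nonneg (mul_nonneg (hρ0 x) (hρ0' x)) hδ.le
    by_cases hx : δ ≤ ρ x
    · have hxA : siteInd A x = 1 := by simp [siteInd, hA, hx]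
      have hxB : siteInd B x = 0 := by simp [siteInd, hB, hx]
      rw [hxA, hxB]
      have := hdiv (ρ x) (ρ' x) (hρ0' x) hx
      constructor <;> linarith
    · have hxA : siteInd A x = 0 := by simp [siteInd, hA, hx]
      push Not at hx
      by_cases hx' : δ ≤ ρ' x
      · have hxB : siteInd B x = 1 := by simp [siteInd, hB, hx, hx']
        rw [hxA, hxB]
        have := hdiv (ρ' x) (ρ x) (hρ0 x) hx'
        rw [mul_comm] at this
        constructor <;> linarith
      · have hxB : siteInd B x = 0 := by simp [siteInd, hB, hx']
        push Not at hx'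
        rw [hxA, hxB]
        constructor <;> linarith
  set S : ℝ := ∑ x, (1 - siteInd A x - siteInd B x) with hS
  set P : ℝ := ∑ x, ρ x * ρ' x with hP
  have hS0 : 0 ≤ S := Finset.sum_nonneg fun x _ => (hpt x).1
  have hP0 : 0 ≤ P := Finset.sum_nonneg fun x _ => mul_nonneg (hρ0 x) (hρ0' x)
  have hSN : (A.card : ℝ) + B.card = N - S := by
    simp only [hS, Finset.sum_sub_distrib, sum_siteInd, Finset.sum_const, Finset.card_univ,
      nsmul_eq_mul, mul_one]
    ring
  have hsum : ∑ x, (1 - siteInd A x) * ρ x + ∑ x, (1 - siteInd B x) * ρ' x ≤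
      P / δ + 2 * δ * S := by
    rw [hP, hS, Finset.sum_div, Finset.mul_sum, ← Finset.sum_add_distrib,
      ← Finset.sum_add_distrib]
    exact Finset.sum_le_sum fun x _ => (hpt x).2
  have hEu := le_trace_of_boundary hd hL hμ0 hμ4 hc hw ht ht1 A hu
  have hEd := le_trace_of_boundary hd hL hμ0 hμ4 hc hw ht ht1 B hdn
  have hEe : hfzE μ U γu γd = ((-(lap d L) - (μ : ℂ) • 1) * γu).trace.re +
      ((-(lap d L) - (μ : ℂ) • 1) * γd).trace.re + U * P := by
    rw [hfzE, Matrix.mul_add, Matrix.trace_add, Complex.add_re]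
  have hbA := bdryCount_nonneg A
  have hbB := bdryCount_nonneg B
  have hKs := mul_le_mul_of_nonneg_left hsum hKpos
  set κ : ℝ := c / (256 * d ^ 2) - t with hκ
  have hκpos : 0 < κ := sub_pos.2 htc
  have htot : κ * bdryCount A + κ * bdryCount B + (h - K * (2 * δ)) * S + (U - K / δ) * P ≤ 0 := by
    have e1 : K * (P / δ + 2 * δ * S) = K / δ * P + K * (2 * δ) * S := by ring
    have e2 : h * A.card + h * B.card = h * N - h * S := by rw [← mul_add, hSN]; ring
    rw [hEe] at hE
    linarith
  have i1 := mul_nonneg hκpos.le hbA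
  have i2 := mul_nonneg hκpos.le hbB
  have i3 := mul_nonneg (sub_pos.2 hδh).le hS0
  have i4 := mul_nonneg (sub_pos.2 hU).le hP0
  have j1 : bdryCount A = 0 :=
    (mul_eq_zero.1 (le_antisymm (by linarith) i1)).resolve_left hκpos.ne'
  have j3 : S = 0 := (mul_eq_zero.1 (le_antisymm (by linarith) i3)).resolve_left (sub_pos.2 hδh).ne'
  have j4 : P = 0 := (mul_eq_zero.1 (le_antisymm (by linarith) i4)).resolve_left (sub_pos.2 hU).ne'
  have hprod : ∀ x, ρ x * ρ' x = 0 := fun x =>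
    (Finset.sum_eq_zero_iff_of_nonneg fun x _ => mul_nonneg (hρ0 x) (hρ0' x)).1 j4 x
      (Finset.mem_univ x)
  have hcov : ∀ x, 1 - siteInd A x - siteInd B x = 0 := fun x =>
    (Finset.sum_eq_zero_iff_of_nonneg fun x _ => (hpt x).1).1 j3 x (Finset.mem_univ x)
  rcases eq_empty_or_eq_univ_of_bdryCount_eq_zero j1 with hA' | hA'
  · left
    refine eq_zero_of_posSemidef_of_diag_eq_zero hu.1 fun x => ?_
    have hx : x ∈ B := by
      by_contra hx
      have := hcov x
      simp [siteInd, hA', hx] at this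
    exact (mul_eq_zero.1 (hprod x)).resolve_right
      (hδ.trans_le (Finset.mem_filter.1 hx).2.2).ne'
  · right
    refine eq_zero_of_posSemidef_of_diag_eq_zero hdn.1 fun x => ?_
    have hx : x ∈ A := hA' ▸ Finset.mem_univ x
    exact (mul_eq_zero.1 (hprod x)).resolve_left (hδ.trans_le (Finset.mem_filter.1 hx).2).ne'

end Minimizers

/-- Theorem 1.1, characterization of minimizers: for `d ≥ 1` and
`0 < μ < 4d` there exist `L_#(μ)` and `U_#(μ) ≥ 0` such that for all even `L ≥ L_#(μ)` and
`U ≥ U_#(μ)`: if `μ` is not an eigenvalue of `-Δ`, then every minimizing pair of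
one-particle density matrices is fully polarized: `(1[-Δ<μ], 0)` or `(0, 1[-Δ<μ])`. -/
theorem hfz_minimizers_saturated (d : ℕ) (hd : 1 ≤ d) (μ : ℝ)
    (hμ0 : 0 < μ) (hμ4 : μ < 4 * d) :
    ∃ (Lsharp : ℕ) (Usharp : ℝ), 0 ≤ Usharp ∧
      ∀ (L : ℕ) [NeZero L], Even L → Lsharp ≤ L →
        ∀ U : ℝ, Usharp ≤ U →
          (∀ v : Lam d L → ℂ, (-(lap d L)).mulVec v = (μ : ℂ) • v → v = 0) →
          ∀ γu γd : Matrix (Lam d L) (Lam d L) ℂ,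
            IsDM γu → IsDM γd →
            (∀ γu' γd' : Matrix (Lam d L) (Lam d L) ℂ, IsDM γu' → IsDM γd' →
              hfzE μ U γu γd ≤ hfzE μ U γu' γd') →
            (γu = specProjLt (-(lap d L)) μ ∧ γd = 0) ∨
              (γu = 0 ∧ γd = specProjLt (-(lap d L)) μ) := by
  obtain ⟨c, hc, L₀, hw⟩ := exists_overlap_bound hd hμ0 hμ4
  have hdpos : (0 : ℝ) < d := by exact_mod_cast hd
  set κ : ℝ := c / (256 * d ^ 2) with hκ
  have hκpos : 0 < κ := by positivity
  set t : ℝ := min (κ / 2) 1 with ht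
  have htpos : 0 < t := lt_min (by positivity) one_pos
  have htκ : t < κ := (min_le_left _ _).trans_lt (by linarith)
  set K : ℝ := 4 * d / t with hK
  have hKpos : 0 < K := by positivity
  set δ : ℝ := c / (4 * d) / (4 * K) with hδ
  have hδpos : 0 < δ := by positivity
  refine ⟨max L₀ 3, K / δ + 1, by positivity, ?_⟩
  intro L _ hLeven hL U hU hμ γu γd hu hdn hmin
  have hL₀ : L₀ ≤ L := (le_max_left _ _).trans hL
  have hL3 : 3 ≤ L := (le_max_right _ _).trans hL
  have hden := le_energyDensity hd hLeven hμ0 (hw L hL₀)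
  have hδh : K * (2 * δ) < energyDensity d L μ := by
    refine lt_of_lt_of_le ?_ hden
    have h0 : 0 < c / (4 * d) := by positivity
    have e : K * (2 * δ) = c / (4 * d) / 2 := by
      rw [hδ]
      field_simp
      norm_num
    rw [e]
    linarith
  have hE : hfzE μ U γu γd ≤ -(energyDensity d L μ * Fintype.card (Lam d L)) := by
    obtain ⟨γ, hγ, hγE⟩ := exists_isDM_trace_eq (d := d) hL3 μ
    rw [← hγE, ← hfzE_zero_right μ U]
    exact hmin γ 0 hγ isDM_zero
  rcases eq_zero_or_eq_zero_of_hfzE_le hd hL3 hμ0 hμ4 hc.le (hw L hL₀) htpos (min_le_right _ _)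
    htκ hδpos hδh (lt_of_lt_of_le (lt_add_one _) hU) hu hdn hE with rfl | rfl
  · refine Or.inr ⟨rfl, eq_specProjLt_of_minimizer (isHermitian_neg_lap hL3) μ hμ hdn.1 hdn.2 ?_⟩
    intro γ' h h'
    simpa only [hfzE_zero_left] using hmin 0 γ' isDM_zero ⟨h, h'⟩
  · refine Or.inl ⟨eq_specProjLt_of_minimizer (isHermitian_neg_lap hL3) μ hμ hu.1 hu.2 ?_, rfl⟩
    intro γ' h h'
    simpa only [hfzE_zero_right] using hmin γ' 0 ⟨h, h'⟩ isDM_zero
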